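/- Consider the Lorenz system ẋ = −σ(x−y), ẏ = rx − y − xz, ż = −bz + xy with σ > 0, b ∈ (0,4], r > 0. If either 2σ ≤ b, or (2σ > b and r < (σ+b)(b+1)/σ), then every solution t ↦ (x(t),y(t),z(t)) defined on [0,∞) converges to the stationary set: the distance from (x(t),y(t),z(t)) to the set of equilibria of the system tends to 0 as t → +∞. -/

import Mathlib

open Filter Topology

/-- Error bound for the explicit Euler method along a solution of `U' = Φ(U)`. -/
theorem norm_euler_sub_le {F : Type*} [NormedAddCommGroup F] [NormedSpace ℝ F]
    {Φ : F → F} {U : ℝ → F} {A : ℕ → F} {t₀ ε Λ M : ℝ} {n : ℕ} {S : Set F}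
    (hε : 0 ≤ ε) (hΛ : 0 ≤ Λ)
    (hU : ∀ t ∈ Set.Icc t₀ (t₀ + n * ε), HasDerivAt U (Φ (U t)) t)
    (hM : ∀ t ∈ Set.Icc t₀ (t₀ + n * ε), ‖Φ (U t)‖ ≤ M)
    (hLip : ∀ a ∈ S, ∀ t ∈ Set.Icc t₀ (t₀ + n * ε), ‖Φ a - Φ (U t)‖ ≤ Λ * ‖a - U t‖)
    (hUS : ∀ t ∈ Set.Icc t₀ (t₀ + n * ε), U t ∈ S)
    (hA0 : A 0 = U t₀) (hA : ∀ j, A (j + 1) = A j + ε • Φ (A j)) (hAS : ∀ j, A j ∈ S) :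
    ∀ j ≤ n, ‖A j - U (t₀ + j * ε)‖ ≤ (1 + ε * Λ) ^ j * (j * (ε ^ 2 * Λ * M)) := by
  intro j
  induction j with
  | zero => intro _; simp [hA0]
  | succ j ih =>
    intro hj
    have hj' : ((j + 1 : ℕ) : ℝ) ≤ n := by exact_mod_cast hj
    push_cast at hj'
    have ih := ih (by omega)
    set s := t₀ + j * ε with hs
    have hs0 : t₀ ≤ s := by rw [hs]; have : 0 ≤ (j : ℝ) * ε := by positivity
                            linarith
    have hs1 : s + ε ≤ t₀ + n * ε := by rw [hs]; nlinarith
    have hsub : ∀ t ∈ Set.Icc s (s + ε), t ∈ Set.Icc t₀ (t₀ + n * ε) := fun t ht =>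
      ⟨hs0.trans ht.1, ht.2.trans hs1⟩
    have hsm : s ∈ Set.Icc s (s + ε) := ⟨le_rfl, by linarith⟩
    have hM0 : 0 ≤ M := (norm_nonneg _).trans (hM s (hsub s hsm))
    have h1 : ∀ t ∈ Set.Icc s (s + ε), ‖U t - U s‖ ≤ M * (t - s) :=
      norm_image_sub_le_of_norm_deriv_le_segment'
        (fun t ht => (hU t (hsub t ht)).hasDerivWithinAt)
        (fun t ht => hM t (hsub t ⟨ht.1, ht.2.le⟩))
    have h2 : ∀ t ∈ Set.Icc s (s + ε),
        ‖(U t - t • Φ (U s)) - (U s - s • Φ (U s))‖ ≤ (Λ * (M * ε)) * (t - s) := by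
      refine norm_image_sub_le_of_norm_deriv_le_segment'
        (f := fun t => U t - t • Φ (U s)) (f' := fun t => Φ (U t) - (1 : ℝ) • Φ (U s))
        (fun t ht => ?_) (fun t ht => ?_)
      · exact ((hU t (hsub t ht)).sub ((hasDerivAt_id t).smul_const _)).hasDerivWithinAt
      · rw [one_smul]
        refine (hLip _ (hUS t (hsub t ⟨ht.1, ht.2.le⟩)) s (hsub s hsm)).trans ?_
        refine mul_le_mul_of_nonneg_left ((h1 t ⟨ht.1, ht.2.le⟩).trans ?_) hΛ
        exact mul_le_mul_of_nonneg_left (by linarith [ht.2]) hM0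
    have h3 := h2 (s + ε) ⟨by linarith, le_rfl⟩
    have h4 := hLip (A j) (hAS j) s (hsub s hsm)
    have key : A (j + 1) - U (t₀ + ((j + 1 : ℕ) : ℝ) * ε) =
        (A j - U s) + ε • (Φ (A j) - Φ (U s)) -
        ((U (s + ε) - (s + ε) • Φ (U s)) - (U s - s • Φ (U s))) := by
      have : t₀ + ((j + 1 : ℕ) : ℝ) * ε = s + ε := by rw [hs]; push_cast; ring
      rw [this, hA]
      module
    rw [key]
    have h5 : ‖ε • (Φ (A j) - Φ (U s))‖ ≤ ε * (Λ * ‖A j - U s‖) := by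
      rw [norm_smul, Real.norm_of_nonneg hε]
      exact mul_le_mul_of_nonneg_left h4 hε
    refine ((norm_sub_le _ _).trans (add_le_add (norm_add_le _ _) h3)).trans ?_
    have h6 : 1 ≤ (1 + ε * Λ) ^ (j + 1) := one_le_pow₀ (by nlinarith [mul_nonneg hε hΛ])
    have h7 : 0 ≤ ε ^ 2 * Λ * M := by positivity
    have h8 := mul_le_mul_of_nonneg_right ih (show 0 ≤ 1 + ε * Λ by positivity)
    push_cast
    calc _ ≤ ‖A j - U s‖ * (1 + ε * Λ) + ε ^ 2 * Λ * M := by nlinarith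
      _ ≤ (1 + ε * Λ) ^ j * (j * (ε ^ 2 * Λ * M)) * (1 + ε * Λ) + ε ^ 2 * Λ * M := by linarith
      _ ≤ (1 + ε * Λ) ^ j * (j * (ε ^ 2 * Λ * M)) * (1 + ε * Λ)
          + (1 + ε * Λ) ^ (j + 1) * (ε ^ 2 * Λ * M) := by nlinarith
      _ = _ := by ring

/-- Stokes' formula on a rectangle for the one-form `v ↦ B (f ·) v` pulled back by `G`. -/
theorem integral_curl_eq_boundary {E : Type*} [NormedAddCommGroup E] [NormedSpace ℝ E]
    {f : E → E} (hf : ContDiff ℝ 1 f) (B : E →L[ℝ] E →L[ℝ] ℝ) {G : ℝ × ℝ → E} {a b : ℝ}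
    (hab : a ≤ b) (hG : ∀ p ∈ Set.Icc (0 : ℝ) 1 ×ˢ Set.Icc a b, ContDiffAt ℝ 2 G p) :
    (∫ s in (0 : ℝ)..1, ∫ τ in a..b,
      (B (fderiv ℝ f (G (s, τ)) (fderiv ℝ G (s, τ) (1, 0))) (fderiv ℝ G (s, τ) (0, 1)) -
       B (fderiv ℝ f (G (s, τ)) (fderiv ℝ G (s, τ) (0, 1))) (fderiv ℝ G (s, τ) (1, 0)))) =
    ((-∫ s in (0 : ℝ)..1, B (f (G (s, b))) (fderiv ℝ G (s, b) (1, 0))) +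
      (∫ s in (0 : ℝ)..1, B (f (G (s, a))) (fderiv ℝ G (s, a) (1, 0))) +
      ∫ τ in a..b, B (f (G (1, τ))) (fderiv ℝ G (1, τ) (0, 1))) -
      ∫ τ in a..b, B (f (G (0, τ))) (fderiv ℝ G (0, τ) (0, 1)) := by
  have hder : ∀ p ∈ Set.Icc (0 : ℝ) 1 ×ˢ Set.Icc a b, ∀ e : ℝ × ℝ,
      HasFDerivAt (fun p => B (f (G p)) (fderiv ℝ G p e))
        (fderiv ℝ (fun p => B (f (G p)) (fderiv ℝ G p e)) p) p ∧
      ∀ v, fderiv ℝ (fun p => B (f (G p)) (fderiv ℝ G p e)) p v =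
        B (fderiv ℝ f (G p) (fderiv ℝ G p v)) (fderiv ℝ G p e) +
        B (f (G p)) (fderiv ℝ (fderiv ℝ G) p v e) := by
    intro p hp e
    have h2 := hG p hp
    have hdG : HasFDerivAt G (fderiv ℝ G p) p :=
      (h2.differentiableAt (by norm_num)).hasFDerivAt
    have hddG : HasFDerivAt (fderiv ℝ G) (fderiv ℝ (fderiv ℝ G) p) p :=
      ((h2.fderiv_right (m := 1) (by norm_num)).differentiableAt (by norm_num)).hasFDerivAt
    have hdf : HasFDerivAt f (fderiv ℝ f (G p)) (G p) :=
      (hf.differentiable (by norm_num) _).hasFDerivAt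
    have h := ((B.hasFDerivAt (x := f (G p))).comp p (hdf.comp p hdG)).clm_apply
      (hddG.clm_apply (hasFDerivAt_const e p))
    refine ⟨h.differentiableAt.hasFDerivAt, fun v => ?_⟩
    have := h.fderiv
    simp only [Function.comp_def] at this
    rw [this]
    simp
    ring
  have hsub : Set.uIcc (0 : ℝ) 1 ×ˢ Set.uIcc a b = Set.Icc (0 : ℝ) 1 ×ˢ Set.Icc a b := by
    rw [Set.uIcc_of_le zero_le_one, Set.uIcc_of_le hab]
  have hsub' : Set.Ioo (min (0 : ℝ) 1) (max 0 1) ×ˢ Set.Ioo (min a b) (max a b) ⊆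
      Set.Icc (0 : ℝ) 1 ×ˢ Set.Icc a b := by
    rw [min_eq_left zero_le_one, max_eq_right zero_le_one, min_eq_left hab, max_eq_right hab]
    exact Set.prod_mono Set.Ioo_subset_Icc_self Set.Ioo_subset_Icc_self
  set ω : ℝ × ℝ → ℝ := fun p =>
    B (fderiv ℝ f (G p) (fderiv ℝ G p (1, 0))) (fderiv ℝ G p (0, 1)) -
       B (fderiv ℝ f (G p) (fderiv ℝ G p (0, 1))) (fderiv ℝ G p (1, 0)) with hω
  have hωeq : ∀ p ∈ Set.Icc (0 : ℝ) 1 ×ˢ Set.Icc a b,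
      fderiv ℝ (fun p => B (f (G p)) (fderiv ℝ G p (0, 1))) p (1, 0) +
      (-fderiv ℝ (fun p => B (f (G p)) (fderiv ℝ G p (1, 0))) p) (0, 1) = ω p := by
    intro p hp
    have hsymm : IsSymmSndFDerivAt ℝ G p := (hG p hp).isSymmSndFDerivAt (by simp)
    rw [neg_apply, (hder p hp _).2, (hder p hp _).2, hsymm.eq (1, 0) (0, 1)]
    simp only [hω]
    ring
  have hcG : ContinuousOn G (Set.Icc (0 : ℝ) 1 ×ˢ Set.Icc a b) := fun p hp =>
    (hG p hp).continuousAt.continuousWithinAt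
  have hcdG : ContinuousOn (fderiv ℝ G) (Set.Icc (0 : ℝ) 1 ×ˢ Set.Icc a b) := fun p hp =>
    ((hG p hp).fderiv_right (m := 1) (by norm_num)).continuousAt.continuousWithinAt
  have hcdf : Continuous (fderiv ℝ f) := hf.continuous_fderiv (by norm_num)
  have hcω : ContinuousOn ω (Set.Icc (0 : ℝ) 1 ×ˢ Set.Icc a b) := by
    have hcdf' := hcdf.comp_continuousOn hcG
    have he : ∀ e, ContinuousOn (fun p => fderiv ℝ G p e) (Set.Icc (0 : ℝ) 1 ×ˢ Set.Icc a b) :=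
      fun e => hcdG.clm_apply continuousOn_const
    exact ((B.continuous.comp_continuousOn (hcdf'.clm_apply (he _))).clm_apply (he _)).sub
      ((B.continuous.comp_continuousOn (hcdf'.clm_apply (he _))).clm_apply (he _))
  have hc : ∀ e, ContinuousOn (fun p => B (f (G p)) (fderiv ℝ G p e))
      (Set.Icc (0 : ℝ) 1 ×ˢ Set.Icc a b) := fun e p hp =>
    (hder p hp e).1.continuousAt.continuousWithinAt
  have main := MeasureTheory.integral2_divergence_prod_of_hasFDerivAt
    (fun p => B (f (G p)) (fderiv ℝ G p (0, 1)))
    (fun p => -B (f (G p)) (fderiv ℝ G p (1, 0)))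
    (fun p => fderiv ℝ (fun p => B (f (G p)) (fderiv ℝ G p (0, 1))) p)
    (fun p => -fderiv ℝ (fun p => B (f (G p)) (fderiv ℝ G p (1, 0))) p) 0 a 1 b
    (by rw [hsub]; exact hc _) (by rw [hsub]; exact (hc _).neg)
    (fun p hp => (hder p (hsub' hp) _).1) (fun p hp => (hder p (hsub' hp) _).1.neg)
    (by
      rw [hsub]
      refine (hcω.integrableOn_compact (isCompact_Icc.prod isCompact_Icc)).congr_fun
        (fun p hp => (hωeq p hp).symm) (measurableSet_Icc.prod measurableSet_Icc))
  have hL : (∫ s in (0 : ℝ)..1, ∫ τ in a..b, ω (s, τ)) =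
      ∫ s in (0 : ℝ)..1, ∫ τ in a..b,
      (fderiv ℝ (fun p => B (f (G p)) (fderiv ℝ G p (0, 1))) (s, τ) (1, 0) +
      (-fderiv ℝ (fun p => B (f (G p)) (fderiv ℝ G p (1, 0))) (s, τ)) (0, 1)) := by
    refine intervalIntegral.integral_congr fun s hs => ?_
    refine intervalIntegral.integral_congr fun τ hτ => ?_
    rw [Set.uIcc_of_le zero_le_one] at hs
    rw [Set.uIcc_of_le hab] at hτ
    exact (hωeq (s, τ) ⟨hs, hτ⟩).symm
  rw [show (∫ s in (0 : ℝ)..1, ∫ τ in a..b, (B (fderiv ℝ f (G (s, τ)) (fderiv ℝ G (s, τ) (1, 0)))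
    (fderiv ℝ G (s, τ) (0, 1)) - B (fderiv ℝ f (G (s, τ)) (fderiv ℝ G (s, τ) (0, 1)))
    (fderiv ℝ G (s, τ) (1, 0)))) = ∫ s in (0 : ℝ)..1, ∫ τ in a..b, ω (s, τ) from rfl, hL, main]
  simp only [intervalIntegral.integral_neg]
  ring

theorem exists_lipschitz_bound_of_contDiff {E F : Type*} [NormedAddCommGroup E] [NormedSpace ℝ E]
    [ProperSpace E] [NormedAddCommGroup F] [NormedSpace ℝ F] {g : E → F} (hg : ContDiff ℝ 1 g)
    {K : Set E} (hK : Bornology.IsBounded K) :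
    ∃ L : ℝ, ∀ v ∈ K, ‖g v‖ ≤ L ∧ ‖fderiv ℝ g v‖ ≤ L ∧ ∀ w ∈ K, ‖g v - g w‖ ≤ L * ‖v - w‖ := by
  obtain ⟨R, hR⟩ := hK.subset_closedBall 0
  obtain ⟨L₁, h₁⟩ := (isCompact_closedBall (0 : E) R).exists_bound_of_continuousOn
    (hg.continuous.continuousOn)
  obtain ⟨L₂, h₂⟩ := (isCompact_closedBall (0 : E) R).exists_bound_of_continuousOn
    ((hg.continuous_fderiv (by norm_num)).continuousOn)
  refine ⟨max L₁ L₂, fun v hv => ⟨(h₁ v (hR hv)).trans (le_max_left _ _),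
    (h₂ v (hR hv)).trans (le_max_right _ _), fun w hw => ?_⟩⟩
  exact (convex_closedBall (0 : E) R).norm_image_sub_le_of_norm_fderiv_le
    (fun x _ => hg.differentiable (by norm_num) x)
    (fun x hx => (h₂ x hx).trans (le_max_right _ _)) (hR hw) (hR hv)

/-- One step of the explicit Euler method for `u' = f(u)` with step size `ε`. -/
def eulerMap {E : Type*} [NormedAddCommGroup E] [NormedSpace ℝ E] (f : E → E) (ε : ℝ) (v : E) : E :=
  v + ε • f v

section EulerMap

variable {E : Type*} [NormedAddCommGroup E] [NormedSpace ℝ E] {f : E → E}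

theorem contDiff_eulerMap_iterate {k : WithTop ℕ∞} (hf : ContDiff ℝ k f) (ε : ℝ) (n : ℕ) :
    ContDiff ℝ k ((eulerMap f ε)^[n]) := by
  induction n with
  | zero => exact contDiff_id
  | succ n ih =>
    rw [Function.iterate_succ']
    exact (contDiff_id.add (contDiff_const.smul hf)).comp ih

theorem fderiv_eulerMap_comp {X : Type*} [NormedAddCommGroup X] [NormedSpace ℝ X]
    (hf : Differentiable ℝ f) (ε : ℝ) {H : X → E} {p : X} (hH : DifferentiableAt ℝ H p) (e : X) :
    fderiv ℝ (fun p => eulerMap f ε (H p)) p e =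
      fderiv ℝ H p e + ε • fderiv ℝ f (H p) (fderiv ℝ H p e) := by
  have h := hH.hasFDerivAt.add (((hf (H p)).hasFDerivAt.comp p hH.hasFDerivAt).const_smul ε)
  have h' : HasFDerivAt (fun p => eulerMap f ε (H p)) _ p := h
  rw [h'.fderiv]
  simp

theorem eulerMap_iterate_mem {K : Set E} {ε : ℝ} (hK : ∀ v ∈ K, v + ε • f v ∈ K) {v : E}
    (hv : v ∈ K) (n : ℕ) : (eulerMap f ε)^[n] v ∈ K := by
  induction n with
  | zero => exact hv
  | succ n ih =>
    rw [Function.iterate_succ_apply']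
    exact hK _ ih

theorem norm_velocity_le {L t τ : ℝ} (hf : Differentiable ℝ f) {u : ℝ → E}
    (hu : ∀ t, 0 < t → HasDerivAt u (f (u t)) t)
    (hL : ∀ t, 0 < t → ‖fderiv ℝ f (u t)‖ ≤ L) (hτ : 0 < τ) (ht : 0 ≤ t) :
    ‖f (u (τ + t))‖ ≤ Real.exp (L * t) * ‖f (u τ)‖ := by
  have hd : ∀ s, 0 < s → HasDerivAt (fun s => f (u s)) (fderiv ℝ f (u s) (f (u s))) s :=
    fun s hs => (hf (u s)).hasFDerivAt.comp_hasDerivAt s (hu s hs)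
  have := norm_le_gronwallBound_of_norm_deriv_right_le (f := fun s => f (u s))
    (f' := fun s => fderiv ℝ f (u s) (f (u s))) (δ := ‖f (u τ)‖) (K := L) (ε := 0)
    (a := τ) (b := τ + t)
    (fun s hs => (hd s (hτ.trans_le hs.1)).continuousAt.continuousWithinAt)
    (fun s hs => (hd s (hτ.trans_le hs.1)).hasDerivWithinAt) le_rfl
    (fun s hs => by
      rw [add_zero]
      exact ((fderiv ℝ f (u s)).le_opNorm _).trans
        (mul_le_mul_of_nonneg_right (hL s (hτ.trans_le hs.1)) (norm_nonneg _)))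
    (τ + t) ⟨by linarith, le_rfl⟩
  rw [gronwallBound_ε0] at this
  rw [show τ + t - τ = t by ring] at this
  linarith

/-- Along a solution `u`, the Euler iterate of the velocity field is close to the true velocity,
with an error that is proportional to the velocity itself. -/
theorem euler_tangent_error [ProperSpace E] (hf : ContDiff ℝ 2 f) {K : Set E}
    (hK : Bornology.IsBounded K) {ε₀ : ℝ} (hinv : ∀ ε ∈ Set.Ioc 0 ε₀, ∀ v ∈ K, v + ε • f v ∈ K)
    {u : ℝ → E} (hu : ∀ t, 0 < t → HasDerivAt u (f (u t)) t) (huK : ∀ t, 0 < t → u t ∈ K)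
    {t : ℝ} (ht : 0 < t) :
    ∃ C, 0 ≤ C ∧ ∀ (n : ℕ) (ε : ℝ), ε ∈ Set.Ioc 0 ε₀ → n * ε = t → ∀ τ, 0 < τ →
      ‖f ((eulerMap f ε)^[n] (u τ)) - f (u (τ + t))‖ ≤ C * ε * ‖f (u τ)‖ ∧
      ‖fderiv ℝ ((eulerMap f ε)^[n]) (u τ) (f (u τ)) - f (u (τ + t))‖ ≤ C * ε * ‖f (u τ)‖ ∧
      ‖f (u (τ + t))‖ ≤ C * ‖f (u τ)‖ := by
  obtain ⟨L₁, h₁⟩ := exists_lipschitz_bound_of_contDiff (hf.of_le (by norm_num)) hK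
  obtain ⟨L₂, h₂⟩ := exists_lipschitz_bound_of_contDiff
    (hf.fderiv_right (m := 1) (by norm_num)) hK
  set L := max 1 (max L₁ L₂) with hLdef
  have hL1 : 1 ≤ L := le_max_left _ _
  have hL₁ : L₁ ≤ L := (le_max_left _ _).trans (le_max_right _ _)
  have hL₂ : L₂ ≤ L := (le_max_right _ _).trans (le_max_right _ _)
  have hL0 : 0 ≤ L := zero_le_one.trans hL1
  have hfd : Differentiable ℝ f := hf.differentiable (by norm_num)
  have hdf : Differentiable ℝ (fderiv ℝ f) :=
    (hf.fderiv_right (m := 1) (by norm_num)).differentiable (by norm_num)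
  set N := Real.exp (L * t) with hN
  have hN1 : 1 ≤ N := Real.one_le_exp (by positivity)
  have hvel : ∀ τ, 0 < τ → ∀ s, 0 ≤ s → s ≤ t → ‖f (u (τ + s))‖ ≤ N * ‖f (u τ)‖ := by
    intro τ hτ s hs hst
    refine (norm_velocity_le hfd hu
      (fun t ht => ((h₁ _ (huK t ht)).2.1).trans hL₁) hτ hs).trans ?_
    refine mul_le_mul_of_nonneg_right (Real.exp_le_exp.2 ?_) (norm_nonneg _)
    exact mul_le_mul_of_nonneg_left hst hL0
  set Λ := L + L * L with hΛ
  have hΛ0 : 0 ≤ Λ := by positivity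
  set D := Real.exp (t * Λ) * (t * (Λ * (L * N))) with hD
  have hD0 : 0 ≤ D := by positivity
  refine ⟨L * D + N, by positivity, fun n ε hε hn τ hτ => ?_⟩
  have hε0 : 0 < ε := hε.1
  set Φ : E × E → E × E := fun w => (f w.1, fderiv ℝ f w.1 w.2) with hΦ
  set U : ℝ → E × E := fun s => (u s, f (u s)) with hU
  set A : ℕ → E × E := fun j =>
    ((eulerMap f ε)^[j] (u τ), fderiv ℝ ((eulerMap f ε)^[j]) (u τ) (f (u τ))) with hA
  have herr := norm_euler_sub_le (Φ := Φ) (U := U) (A := A) (t₀ := τ) (ε := ε) (Λ := Λ)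
    (M := L * N * ‖f (u τ)‖) (n := n) (S := {w | w.1 ∈ K}) hε0.le hΛ0
    (fun s hs => by
      have hs0 : 0 < s := hτ.trans_le hs.1
      exact (hu s hs0).prodMk ((hfd (u s)).hasFDerivAt.comp_hasDerivAt s (hu s hs0)))
    (fun s hs => by
      have hs0 : 0 < s := hτ.trans_le hs.1
      have hv := hvel τ hτ (s - τ) (by linarith [hs.1]) (by linarith [hs.2])
      rw [add_sub_cancel] at hv
      have hnn : 0 ≤ N * ‖f (u τ)‖ := by positivity
      simp only [hΦ, hU, Prod.norm_def]
      refine max_le ?_ ?_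
      · nlinarith
      · refine ((fderiv ℝ f (u s)).le_opNorm _).trans ?_
        rw [mul_assoc]
        exact mul_le_mul (((h₁ _ (huK s hs0)).2.1).trans hL₁) hv (norm_nonneg _) hL0)
    (fun a ha s hs => by
      have hs0 : 0 < s := hτ.trans_le hs.1
      have hus := huK s hs0
      have ha1 : ‖a.1 - u s‖ ≤ ‖a - U s‖ := norm_fst_le (a - U s)
      have ha2 : ‖a.2 - f (u s)‖ ≤ ‖a - U s‖ := norm_snd_le (a - U s)
      change max ‖f a.1 - f (u s)‖ ‖fderiv ℝ f a.1 a.2 - fderiv ℝ f (u s) (f (u s))‖ ≤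
        Λ * ‖a - U s‖
      have e0 := norm_nonneg (a - U s)
      have hLL : 0 ≤ L * L := by positivity
      refine max_le ?_ ?_
      · have := (h₁ _ ha).2.2 _ hus
        have h3 : L₁ * ‖a.1 - u s‖ ≤ L * ‖a - U s‖ :=
          mul_le_mul hL₁ ha1 (norm_nonneg _) hL0
        nlinarith
      · have hsplit : fderiv ℝ f a.1 a.2 - fderiv ℝ f (u s) (f (u s)) =
            fderiv ℝ f a.1 (a.2 - f (u s)) + (fderiv ℝ f a.1 - fderiv ℝ f (u s)) (f (u s)) := by
          simp
        rw [hsplit]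
        refine (norm_add_le _ _).trans ?_
        have h3 : ‖fderiv ℝ f a.1 (a.2 - f (u s))‖ ≤ L * ‖a - U s‖ :=
          ((fderiv ℝ f a.1).le_opNorm _).trans
            (mul_le_mul (((h₁ _ ha).2.1).trans hL₁) ha2 (norm_nonneg _) hL0)
        have h5 : ‖fderiv ℝ f a.1 - fderiv ℝ f (u s)‖ ≤ L * ‖a - U s‖ :=
          ((h₂ _ ha).2.2 _ hus).trans (mul_le_mul hL₂ ha1 (norm_nonneg _) hL0)
        have h4 : ‖(fderiv ℝ f a.1 - fderiv ℝ f (u s)) (f (u s))‖ ≤ L * ‖a - U s‖ * L :=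
          ((fderiv ℝ f a.1 - fderiv ℝ f (u s)).le_opNorm _).trans
            (mul_le_mul h5 (((h₁ _ hus).1).trans hL₁) (norm_nonneg _) (by positivity))
        rw [hΛ]
        linarith)
    (fun s hs => huK s (hτ.trans_le hs.1))
    (by simp [hA, hU])
    (fun j => by
      have hdj := fderiv_eulerMap_comp hfd ε
        ((contDiff_eulerMap_iterate hf ε j).differentiable (by norm_num) (u τ)) (f (u τ))
      simp only [hA, hΦ, Prod.smul_mk, Prod.mk_add_mk, Function.iterate_succ']
      exact Prod.ext rfl hdj)
    (fun j => eulerMap_iterate_mem (hinv ε hε) (huK τ hτ) j) n le_rfl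
  rw [hn] at herr
  have hbound : ‖A n - U (τ + t)‖ ≤ D * ε * ‖f (u τ)‖ := by
    refine herr.trans ?_
    have hexp : (1 + ε * Λ) ^ n ≤ Real.exp (t * Λ) := by
      rw [← hn, mul_assoc, Real.exp_nat_mul]
      refine pow_le_pow_left₀ (by positivity) ?_ _
      linarith [Real.add_one_le_exp (ε * Λ)]
    calc _ ≤ Real.exp (t * Λ) * (n * (ε ^ 2 * Λ * (L * N * ‖f (u τ)‖))) :=
          mul_le_mul_of_nonneg_right hexp (by positivity)
      _ = Real.exp (t * Λ) * ((n * ε) * (Λ * (L * N))) * ε * ‖f (u τ)‖ := by ring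
      _ = _ := by rw [hn]
  have hX : 0 ≤ ‖f (u τ)‖ := norm_nonneg _
  have hεX : 0 ≤ ε * ‖f (u τ)‖ := by positivity
  have hN0 : 0 ≤ N := by positivity
  refine ⟨?_, ?_, ?_⟩
  · have h3 := (h₁ _ (eulerMap_iterate_mem (hinv ε hε) (huK τ hτ) n)).2.2 _
      (huK (τ + t) (by linarith))
    have h4 : ‖(eulerMap f ε)^[n] (u τ) - u (τ + t)‖ ≤ D * ε * ‖f (u τ)‖ :=
      (norm_fst_le (A n - U (τ + t))).trans hbound
    have h5 := h3.trans (mul_le_mul hL₁ h4 (norm_nonneg _) hL0)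
    nlinarith [mul_nonneg hN0 hεX]
  · have h4 : ‖fderiv ℝ ((eulerMap f ε)^[n]) (u τ) (f (u τ)) - f (u (τ + t))‖ ≤
      D * ε * ‖f (u τ)‖ := (norm_snd_le (A n - U (τ + t))).trans hbound
    refine h4.trans ?_
    rw [mul_assoc D, mul_assoc (L * D + N)]
    refine mul_le_mul_of_nonneg_right ?_ hεX
    nlinarith
  · refine (hvel τ hτ t ht.le le_rfl).trans (mul_le_mul_of_nonneg_right ?_ hX)
    have : 0 ≤ L * D := by positivity
    linarith

end EulerMap

theorem contDiffAt_solution {E : Type*} [NormedAddCommGroup E] [NormedSpace ℝ E] {f : E → E}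
    (hf : ContDiff ℝ 2 f) {u : ℝ → E} (hu : ∀ t, 0 < t → HasDerivAt u (f (u t)) t)
    {t : ℝ} (ht : 0 < t) : ContDiffAt ℝ 2 u t := by
  have hd : DifferentiableOn ℝ u (Set.Ioi 0) := fun t ht =>
    (hu t ht).differentiableAt.differentiableWithinAt
  have hderiv : Set.EqOn (deriv u) (fun t => f (u t)) (Set.Ioi 0) := fun t ht => (hu t ht).deriv
  have h1 : ContDiffOn ℝ 1 u (Set.Ioi 0) := by
    rw [show (1 : WithTop ℕ∞) = 0 + 1 by norm_num, contDiffOn_succ_iff_deriv_of_isOpen isOpen_Ioi]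
    refine ⟨hd, by simp, ?_⟩
    rw [contDiffOn_zero]
    exact (hf.continuous.comp_continuousOn hd.continuousOn).congr hderiv
  have h2 : ContDiffOn ℝ 2 u (Set.Ioi 0) := by
    rw [show (2 : WithTop ℕ∞) = 1 + 1 by norm_num, contDiffOn_succ_iff_deriv_of_isOpen isOpen_Ioi]
    exact ⟨hd, by simp, ((hf.of_le (by norm_num)).comp_contDiffOn h1).congr hderiv⟩
  exact h2.contDiffAt (Ioi_mem_nhds ht)

theorem area_eulerMap_iterate_le {E : Type*} [NormedAddCommGroup E] [NormedSpace ℝ E] {f : E → E}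
    (hf : ContDiff ℝ 2 f) {K : Set E} {ε ρ : ℝ} (hinv : ∀ v ∈ K, v + ε • f v ∈ K)
    {ar : E → E → E → ℝ} (hρ : 0 ≤ ρ)
    (har : ∀ v ∈ K, ∀ p q, ar (v + ε • f v) (p + ε • fderiv ℝ f v p) (q + ε • fderiv ℝ f v q) ≤
      ρ * ar v p q) {v : E} (hv : v ∈ K) (p q : E) (n : ℕ) :
    ar ((eulerMap f ε)^[n] v) (fderiv ℝ ((eulerMap f ε)^[n]) v p)
      (fderiv ℝ ((eulerMap f ε)^[n]) v q) ≤ ρ ^ n * ar v p q := by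
  induction n with
  | zero => simp
  | succ n ih =>
    have hd : ∀ e, fderiv ℝ ((eulerMap f ε)^[n + 1]) v e =
        fderiv ℝ ((eulerMap f ε)^[n]) v e +
          ε • fderiv ℝ f ((eulerMap f ε)^[n] v) (fderiv ℝ ((eulerMap f ε)^[n]) v e) := fun e => by
      rw [Function.iterate_succ']
      exact fderiv_eulerMap_comp (hf.differentiable (by norm_num)) ε
        ((contDiff_eulerMap_iterate hf ε n).differentiable (by norm_num) v) e
    rw [hd, hd, Function.iterate_succ_apply']
    refine (har _ (eulerMap_iterate_mem hinv hv n) _ _).trans ?_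
    rw [pow_succ', mul_assoc]
    exact mul_le_mul_of_nonneg_left ih hρ

theorem sub_le_apply_apply_of_norm_sub_le {E : Type*} [NormedAddCommGroup E] [NormedSpace ℝ E]
    (B : E →L[ℝ] E →L[ℝ] ℝ) (hB : ∀ v, ‖v‖ ^ 2 ≤ B v v) {F a d : E} {C ε X : ℝ} (hX : 0 ≤ X)
    (hC : 0 ≤ C) (hε : 0 ≤ ε) (hε1 : ε ≤ 1) (hεC : 3 * ‖B‖ * C ^ 2 * ε ≤ 1 / 4)
    (hF : ‖F‖ ≤ C * X) (ha : ‖a - F‖ ≤ C * ε * X) (hd : ‖d - F‖ ≤ C * ε * X) :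
    ‖F‖ ^ 2 - 1 / 4 * X ^ 2 ≤ B a d := by
  have hsplit : B a d = B F F + B F (d - F) + B (a - F) F + B (a - F) (d - F) := by
    simp only [map_sub, sub_apply]
    ring
  have f1 := B.le_opNorm₂ F (d - F)
  have f2 := B.le_opNorm₂ (a - F) F
  have f3 := B.le_opNorm₂ (a - F) (d - F)
  rw [Real.norm_eq_abs] at f1 f2 f3
  have hd' : ‖d - F‖ ≤ C * 1 * X := hd.trans (by gcongr)
  have g1 : ‖B‖ * ‖F‖ * ‖d - F‖ ≤ ‖B‖ * (C * X) * (C * ε * X) := by gcongr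
  have g2 : ‖B‖ * ‖a - F‖ * ‖F‖ ≤ ‖B‖ * (C * ε * X) * (C * X) := by gcongr
  have g3 : ‖B‖ * ‖a - F‖ * ‖d - F‖ ≤ ‖B‖ * (C * ε * X) * (C * 1 * X) := by gcongr
  have g4 := mul_le_mul_of_nonneg_right hεC (sq_nonneg X)
  linarith [hB F, (abs_le.1 f1).1, (abs_le.1 f2).1, (abs_le.1 f3).1]

/-- If the two-dimensional area is uniformly contracted and every trajectory can be deformed,
with velocity controlled by the vector field, onto a fixed curve, then the squared velocity is
integrable along the trajectories. -/
theorem exists_bound_integral_sq_velocity {E : Type*} [NormedAddCommGroup E] [NormedSpace ℝ E]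
    [ProperSpace E] {f : E → E} (hf : ContDiff ℝ 2 f) (B : E →L[ℝ] E →L[ℝ] ℝ)
    (hB : ∀ v, ‖v‖ ^ 2 ≤ B v v) {K K₀ : Set E} (hK : Bornology.IsBounded K) (hK₀ : K₀ ⊆ K)
    {ε₀ : ℝ} (hε₀ : 0 < ε₀) (hinv : ∀ ε ∈ Set.Ioc 0 ε₀, ∀ v ∈ K, v + ε • f v ∈ K)
    {ar : E → E → E → ℝ} {c C₀ C₁ C₂ : ℝ} (hc : 0 < c) (hC₀ : 0 ≤ C₀) (hC₁ : 0 ≤ C₁)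
    (har : ∀ ε ∈ Set.Ioc 0 ε₀, ∀ v ∈ K, ∀ p q,
      ar (v + ε • f v) (p + ε • fderiv ℝ f v p) (q + ε • fderiv ℝ f v q) ≤
      (1 - c * ε) * ar v p q)
    (har₀ : ∀ v ∈ K, ∀ p q, (B (fderiv ℝ f v p) q - B (fderiv ℝ f v q) p) ^ 2 ≤ C₀ * ar v p q)
    (har₁ : ∀ v ∈ K, ∀ p q, ar v p q ≤ C₁ * (‖p‖ ^ 2 * ‖q‖ ^ 2))
    {h : ℝ × E → E} (hh : ContDiff ℝ 2 h) (hh0 : ∀ v, h (0, v) = v)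
    {γ : ℝ → E} (hγ : ContDiff ℝ 1 γ) {ξ : E → ℝ} (hξ : ContDiff ℝ 1 ξ)
    (hh1 : ∀ v, h (1, v) = γ (ξ v)) (hhK : ∀ s ∈ Set.Icc (0 : ℝ) 1, ∀ v ∈ K₀, h (s, v) ∈ K)
    (hhs : ∀ s ∈ Set.Icc (0 : ℝ) 1, ∀ v ∈ K₀, ‖fderiv ℝ h (s, v) (1, 0)‖ ≤ C₂ * ‖f v‖)
    {u : ℝ → E} (hu : ∀ t, 0 < t → HasDerivAt u (f (u t)) t) (huK : ∀ t, 0 < t → u t ∈ K₀) :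
    ∃ M, ∀ T, 1 ≤ T → ∫ τ in (1 : ℝ)..T, ‖f (u τ)‖ ^ 2 ≤ M := by
  have hfd : Differentiable ℝ f := hf.differentiable (by norm_num)
  have hhd : Differentiable ℝ h := hh.differentiable (by norm_num)
  obtain ⟨R, hR⟩ := hK.subset_closedBall 0
  have hcpt : IsCompact (Set.Icc (0 : ℝ) 1 ×ˢ Metric.closedBall (0 : E) R) :=
    isCompact_Icc.prod (isCompact_closedBall _ _)
  have huR : ∀ t, 0 < t → u t ∈ Metric.closedBall (0 : E) R := fun t ht => hR (hK₀ (huK t ht))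
  have hcdh : Continuous (fderiv ℝ h) := hh.continuous_fderiv (by norm_num)
  obtain ⟨C₃, hC₃⟩ := hcpt.exists_bound_of_continuousOn hcdh.continuousOn
  have hC₃0 : 0 ≤ C₃ := (norm_nonneg _).trans (hC₃ (0, u 1) ⟨by simp, huR 1 one_pos⟩)
  -- choice of the evolution time and of the step size
  obtain ⟨t, ht, htθ⟩ : ∃ t : ℝ, 0 < t ∧
      C₀ * Real.exp (-(c * t)) * C₁ * (C₂ * C₃) ^ 2 ≤ (1 / 4) ^ 2 := by
    have hlim : Tendsto (fun t : ℝ => C₀ * Real.exp (-(c * t)) * C₁ * (C₂ * C₃) ^ 2) atTop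
        (𝓝 (C₀ * 0 * C₁ * (C₂ * C₃) ^ 2)) :=
      ((((Real.tendsto_exp_neg_atTop_nhds_zero.comp
        (tendsto_id.const_mul_atTop hc)).const_mul C₀).mul_const _).mul_const _)
    have hev := hlim.eventually (gt_mem_nhds (show C₀ * 0 * C₁ * (C₂ * C₃) ^ 2 < (1 / 4) ^ 2 by
      norm_num))
    obtain ⟨t, h1, h2⟩ := (hev.and (eventually_gt_atTop 0)).exists
    exact ⟨t, h2, h1.le⟩
  have huK' : ∀ t, 0 < t → u t ∈ K := fun t ht => hK₀ (huK t ht)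
  obtain ⟨C, hC0, hC⟩ := euler_tangent_error hf hK hinv hu huK' ht
  obtain ⟨n, ε, hε0, hεε₀, hε1, hcε, hεC, hnε⟩ : ∃ (n : ℕ) (ε : ℝ), 0 < ε ∧ ε ≤ ε₀ ∧ ε ≤ 1 ∧
      c * ε ≤ 1 ∧ 3 * ‖B‖ * C ^ 2 * ε ≤ 1 / 4 ∧ n * ε = t := by
    have hlim : Tendsto (fun n : ℕ => t / (n : ℝ)) atTop (𝓝 0) :=
      tendsto_const_div_atTop_nhds_zero_nat t
    have e1 := hlim.eventually (gt_mem_nhds hε₀)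
    have e2 := hlim.eventually (gt_mem_nhds one_pos)
    have e3 := (hlim.const_mul c).eventually (gt_mem_nhds (by simp : c * 0 < 1))
    have e4 := (hlim.const_mul (3 * ‖B‖ * C ^ 2)).eventually
      (gt_mem_nhds (by simp : 3 * ‖B‖ * C ^ 2 * 0 < 1 / 4))
    obtain ⟨n, h1, h2, h3, h4, h5⟩ :=
      (e1.and (e2.and (e3.and (e4.and (eventually_gt_atTop 0))))).exists
    have hn : (0 : ℝ) < n := by exact_mod_cast h5
    exact ⟨n, t / n, by positivity, h1.le, h2.le, h3.le, h4.le, by field_simp⟩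
  have hεm : ε ∈ Set.Ioc 0 ε₀ := ⟨hε0, hεε₀⟩
  set P := (eulerMap f ε)^[n] with hP
  have hPc : ContDiff ℝ 2 P := contDiff_eulerMap_iterate hf ε n
  have hPd : Differentiable ℝ P := hPc.differentiable (by norm_num)
  have hcdP : Continuous (fderiv ℝ P) := hPc.continuous_fderiv (by norm_num)
  set G : ℝ × ℝ → E := fun p => P (h (p.1, u p.2)) with hGdef
  have hGderiv : ∀ s τ, 0 < τ → ∀ e : ℝ × ℝ, fderiv ℝ G (s, τ) e =
      fderiv ℝ P (h (s, u τ)) (fderiv ℝ h (s, u τ) (e.1, e.2 • f (u τ))) := by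
    intro s τ hτ e
    have h0 : HasFDerivAt (fun p : ℝ × ℝ => u p.2) _ (s, τ) :=
      (hu τ hτ).hasFDerivAt.comp (s, τ) (hasFDerivAt_snd (𝕜 := ℝ) (E := ℝ) (F := ℝ))
    have h1 := (hasFDerivAt_fst (𝕜 := ℝ) (E := ℝ) (F := ℝ) (p := (s, τ))).prodMk h0
    have h2 : HasFDerivAt G _ (s, τ) :=
      (hPd (h (s, u τ))).hasFDerivAt.comp (s, τ)
        ((hhd (s, u τ)).hasFDerivAt.comp (s, τ) h1)
    rw [h2.fderiv]
    simp
  have hG2 : ∀ T, ∀ p ∈ Set.Icc (0 : ℝ) 1 ×ˢ Set.Icc 1 T, ContDiffAt ℝ 2 G p := by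
    rintro T ⟨s, τ⟩ ⟨-, hτ⟩
    have hτ0 : 0 < τ := one_pos.trans_le hτ.1
    exact hPc.contDiffAt.comp (s, τ) (hh.contDiffAt.comp (s, τ)
      (contDiffAt_fst.prodMk ((contDiffAt_solution hf hu hτ0).comp (s, τ) contDiffAt_snd)))
  -- transversal boundary terms
  obtain ⟨M₂, hM₂⟩ : ∃ M₂, ∀ τ, 0 < τ →
      |∫ s in (0 : ℝ)..1, B (f (G (s, τ))) (fderiv ℝ G (s, τ) (1, 0))| ≤ M₂ := by
    have hcont : Continuous (fun w : ℝ × E =>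
        B (f (P (h w))) (fderiv ℝ P (h w) (fderiv ℝ h w (1, 0)))) := by
      have h1 := hh.continuous
      have h2 : Continuous fun w : ℝ × E => fderiv ℝ P (h w) (fderiv ℝ h w (1, 0)) :=
        (hcdP.comp h1).clm_apply (hcdh.clm_apply continuous_const)
      exact (B.continuous.comp (hf.continuous.comp (hPc.continuous.comp h1))).clm_apply h2
    obtain ⟨M₂, h₂⟩ := hcpt.exists_bound_of_continuousOn hcont.continuousOn
    refine ⟨M₂ * |1 - 0|, fun τ hτ => ?_⟩
    rw [← Real.norm_eq_abs]
    refine intervalIntegral.norm_integral_le_of_norm_le_const fun s hs => ?_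
    rw [Set.uIoc_of_le zero_le_one] at hs
    rw [hGderiv s τ hτ]
    have := h₂ (s, u τ) ⟨⟨hs.1.le, hs.2⟩, huR τ hτ⟩
    simpa using this
  -- the boundary term on the limiting curve
  obtain ⟨M₁, hM₁⟩ : ∃ M₁, ∀ T, 1 ≤ T →
      |∫ τ in (1 : ℝ)..T, B (f (G (1, τ))) (fderiv ℝ G (1, τ) (0, 1))| ≤ M₁ := by
    obtain ⟨R₁, hR₁⟩ := (isCompact_closedBall (0 : E) R).exists_bound_of_continuousOn
      hξ.continuous.continuousOn
    have hβ : ContDiff ℝ 1 (fun a => P (γ a)) := (hPc.of_le (by norm_num)).comp hγ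
    have hΨ : Continuous fun a => B (f (P (γ a))) (deriv (fun a => P (γ a)) a) :=
      (B.continuous.comp (hf.continuous.comp hβ.continuous)).clm_apply
        (hβ.continuous_deriv (by norm_num))
    obtain ⟨M, hM⟩ := (isCompact_Icc (a := -R₁) (b := R₁)).exists_bound_of_continuousOn
      hΨ.continuousOn
    have hξR : ∀ τ, 0 < τ → ξ (u τ) ∈ Set.Icc (-R₁) R₁ := fun τ hτ =>
      abs_le.1 (hR₁ _ (huR τ hτ))
    have hM0 : 0 ≤ M := (norm_nonneg _).trans (hM _ (hξR 1 one_pos))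
    refine ⟨M * (2 * R₁), fun T hT => ?_⟩
    have hζ : ∀ τ, 0 < τ → HasDerivAt (fun τ => ξ (u τ)) (fderiv ℝ ξ (u τ) (f (u τ))) τ :=
      fun τ hτ => (hξ.differentiable (by norm_num) (u τ)).hasFDerivAt.comp_hasDerivAt τ (hu τ hτ)
    have hpos : ∀ τ ∈ Set.uIcc 1 T, 0 < τ := fun τ hτ => by
      rw [Set.uIcc_of_le hT] at hτ
      linarith [hτ.1]
    have hcu : ContinuousOn u (Set.uIcc 1 T) := fun τ hτ =>
      (hu τ (hpos τ hτ)).continuousAt.continuousWithinAt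
    have hsub := intervalIntegral.integral_comp_mul_deriv (a := 1) (b := T)
      (fun τ hτ => hζ τ (hpos τ hτ))
      (((hξ.continuous_fderiv (by norm_num)).comp_continuousOn hcu).clm_apply
        (hf.continuous.comp_continuousOn hcu)) hΨ
    have heq : ∫ τ in (1 : ℝ)..T, B (f (G (1, τ))) (fderiv ℝ G (1, τ) (0, 1)) =
        ∫ τ in (1 : ℝ)..T, ((fun a => B (f (P (γ a))) (deriv (fun a => P (γ a)) a)) ∘
          fun τ => ξ (u τ)) τ * fderiv ℝ ξ (u τ) (f (u τ)) := by
      refine intervalIntegral.integral_congr fun τ hτ => ?_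
      have hτ0 := hpos τ hτ
      have hGd : HasDerivAt (fun τ => G (1, τ)) (fderiv ℝ G (1, τ) (0, 1)) τ := by
        have h1 : HasDerivAt (fun τ : ℝ => ((1 : ℝ), τ)) (0, 1) τ :=
          (hasDerivAt_const _ _).prodMk (hasDerivAt_id _)
        exact HasFDerivAt.comp_hasDerivAt τ ((hG2 T (1, τ) ⟨by simp, by
          rwa [Set.uIcc_of_le hT] at hτ⟩).differentiableAt (by norm_num)).hasFDerivAt h1
      have hGd' : HasDerivAt (fun τ => G (1, τ))
          (fderiv ℝ ξ (u τ) (f (u τ)) • deriv (fun a => P (γ a)) (ξ (u τ))) τ := by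
        have h1 := ((hβ.differentiable (by norm_num) (ξ (u τ))).hasDerivAt).scomp τ (hζ τ hτ0)
        have h2 : (fun τ => G (1, τ)) = (fun a => P (γ a)) ∘ fun τ => ξ (u τ) := by
          funext τ
          simp only [hGdef, hh1, Function.comp]
        rw [h2]
        exact h1
      simp only [Function.comp]
      rw [hGd.unique hGd', map_smul, smul_eq_mul, mul_comm]
      simp only [hGdef, hh1]
    rw [heq, hsub, ← Real.norm_eq_abs]
    refine (intervalIntegral.norm_integral_le_of_norm_le_const (C := M) fun a ha => ?_).trans ?_
    · exact hM a (Set.uIcc_subset_Icc (hξR 1 one_pos) (hξR T (by linarith)) (Set.uIoc_subset_uIcc ha))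
    · have h1 := hξR 1 one_pos
      have h2 := hξR T (by linarith)
      refine mul_le_mul_of_nonneg_left (abs_le.2 ⟨?_, ?_⟩) hM0
      · linarith [h1.2, h2.1]
      · linarith [h1.1, h2.2]
  have hucont : ContinuousOn u (Set.Ioi 0) := fun τ hτ => (hu τ hτ).continuousAt.continuousWithinAt
  have hfucont : ContinuousOn (fun τ => f (u τ)) (Set.Ioi 0) := hf.continuous.comp_continuousOn hucont
  have hφcont : ContinuousOn (fun τ => ‖f (u τ)‖ ^ 2) (Set.Ioi 0) := hfucont.norm.pow 2
  have hint : ∀ a b, 0 < a → 0 < b →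
      IntervalIntegrable (fun τ => ‖f (u τ)‖ ^ 2) MeasureTheory.volume a b := fun a b ha hb =>
    (hφcont.mono fun τ hτ => (lt_min ha hb).trans_le hτ.1).intervalIntegrable
  refine ⟨2 * ((∫ τ in (1 : ℝ)..(1 + t), ‖f (u τ)‖ ^ 2) + M₁ + 2 * M₂), fun T hT => ?_⟩
  have hT0 : 0 < T := by linarith
  have stokes := integral_curl_eq_boundary (hf.of_le (by norm_num)) B hT (hG2 T)
  set I := ∫ τ in (1 : ℝ)..T, ‖f (u τ)‖ ^ 2 with hI
  -- the area term
  have harea : |∫ s in (0 : ℝ)..1, ∫ τ in (1 : ℝ)..T,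
      (B (fderiv ℝ f (G (s, τ)) (fderiv ℝ G (s, τ) (1, 0))) (fderiv ℝ G (s, τ) (0, 1)) -
       B (fderiv ℝ f (G (s, τ)) (fderiv ℝ G (s, τ) (0, 1))) (fderiv ℝ G (s, τ) (1, 0)))| ≤
      1 / 4 * I := by
    have hs : ∀ s ∈ Set.uIoc (0 : ℝ) 1, ‖∫ τ in (1 : ℝ)..T,
      (B (fderiv ℝ f (G (s, τ)) (fderiv ℝ G (s, τ) (1, 0))) (fderiv ℝ G (s, τ) (0, 1)) -
       B (fderiv ℝ f (G (s, τ)) (fderiv ℝ G (s, τ) (0, 1))) (fderiv ℝ G (s, τ) (1, 0)))‖ ≤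
       1 / 4 * I := by
      intro s hs
      rw [Set.uIoc_of_le zero_le_one] at hs
      have hsI : s ∈ Set.Icc (0 : ℝ) 1 := ⟨hs.1.le, hs.2⟩
      rw [hI, ← intervalIntegral.integral_const_mul]
      refine intervalIntegral.norm_integral_le_of_norm_le hT (MeasureTheory.ae_of_all _ fun τ hτ => ?_)
        ((hint 1 T one_pos hT0).const_mul _)
      have hτ0 : 0 < τ := one_pos.trans hτ.1
      have hX : 0 ≤ ‖f (u τ)‖ := norm_nonneg _
      refine abs_le_of_sq_le_sq ?_ (by positivity)
      have hvK := hhK s hsI _ (huK τ hτ0)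
      rw [hGderiv s τ hτ0, hGderiv s τ hτ0]
      simp only [zero_smul, one_smul]
      set p := fderiv ℝ h (s, u τ) (1, 0) with hp
      set q := fderiv ℝ h (s, u τ) (0, f (u τ)) with hq
      have hpn : ‖p‖ ≤ C₂ * ‖f (u τ)‖ := hhs s hsI _ (huK τ hτ0)
      have hqn : ‖q‖ ≤ C₃ * ‖f (u τ)‖ := by
        refine ((fderiv ℝ h (s, u τ)).le_opNorm _).trans
          (mul_le_mul (hC₃ (s, u τ) ⟨hsI, huR τ hτ0⟩) ?_ (norm_nonneg _) hC₃0)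
        simp [Prod.norm_def]
      have hexp : (1 - c * ε) ^ n ≤ Real.exp (-(c * t)) := by
        rw [← hnε, show -(c * (n * ε)) = n * (-(c * ε)) by ring, Real.exp_nat_mul]
        refine pow_le_pow_left₀ (by linarith) ?_ _
        linarith [Real.add_one_le_exp (-(c * ε))]
      have hpq : ‖p‖ ^ 2 * ‖q‖ ^ 2 ≤ (C₂ * ‖f (u τ)‖) ^ 2 * (C₃ * ‖f (u τ)‖) ^ 2 := by gcongr
      have hn0 : 0 ≤ (1 - c * ε) ^ n := pow_nonneg (by linarith) _
      have hPK : P (h (s, u τ)) ∈ K := eulerMap_iterate_mem (hinv ε hεm) hvK n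
      calc _ ≤ C₀ * ar (P (h (s, u τ))) (fderiv ℝ P (h (s, u τ)) p)
              (fderiv ℝ P (h (s, u τ)) q) := har₀ _ hPK _ _
        _ ≤ C₀ * ((1 - c * ε) ^ n * ar (h (s, u τ)) p q) := by
            gcongr
            exact area_eulerMap_iterate_le hf (hinv ε hεm) (by linarith) (har ε hεm) hvK p q n
        _ ≤ C₀ * ((1 - c * ε) ^ n * (C₁ * (‖p‖ ^ 2 * ‖q‖ ^ 2))) := by
            gcongr
            exact har₁ _ hvK p q
        _ ≤ C₀ * (Real.exp (-(c * t)) *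
              (C₁ * ((C₂ * ‖f (u τ)‖) ^ 2 * (C₃ * ‖f (u τ)‖) ^ 2))) := by gcongr
        _ = C₀ * Real.exp (-(c * t)) * C₁ * (C₂ * C₃) ^ 2 * (‖f (u τ)‖ ^ 2) ^ 2 := by ring
        _ ≤ (1 / 4) ^ 2 * (‖f (u τ)‖ ^ 2) ^ 2 := by gcongr
        _ = _ := by ring
    refine (intervalIntegral.norm_integral_le_of_norm_le_const hs).trans ?_
    simp
  -- the term along the evolved trajectory
  have hmain : I - (∫ τ in (1 : ℝ)..(1 + t), ‖f (u τ)‖ ^ 2) - 1 / 4 * I ≤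
      ∫ τ in (1 : ℝ)..T, B (f (G (0, τ))) (fderiv ℝ G (0, τ) (0, 1)) := by
    have hG0 : ∀ τ, 0 < τ → fderiv ℝ G (0, τ) (0, 1) = fderiv ℝ P (u τ) (f (u τ)) := by
      intro τ hτ
      have h1 : HasFDerivAt (fun v : E => h (0, v)) _ (u τ) :=
        (hhd (0, u τ)).hasFDerivAt.comp (u τ)
          ((hasFDerivAt_const (0 : ℝ) (u τ)).prodMk (hasFDerivAt_id (u τ)))
      have h2 : (fun v : E => h (0, v)) = id := funext hh0
      rw [h2] at h1
      have h3 := congrArg (fun A : E →L[ℝ] E => A (f (u τ))) (h1.unique (hasFDerivAt_id (u τ)))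
      simp only [ContinuousLinearMap.comp_apply, ContinuousLinearMap.prod_apply, zero_apply,
        ContinuousLinearMap.id_apply] at h3
      rw [hGderiv 0 τ hτ]
      simp only [one_smul]
      rw [h3, hh0]
    have hpt : ∀ τ ∈ Set.Icc 1 T, ‖f (u (τ + t))‖ ^ 2 - 1 / 4 * ‖f (u τ)‖ ^ 2 ≤
        B (f (P (u τ))) (fderiv ℝ P (u τ) (f (u τ))) := by
      intro τ hτ
      have hτ0 : 0 < τ := one_pos.trans_le hτ.1
      obtain ⟨e1, e2, e3⟩ := hC n ε hεm hnε τ hτ0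
      rw [← hP] at e1 e2
      exact sub_le_apply_apply_of_norm_sub_le B hB (norm_nonneg _) hC0 hε0.le hε1 hεC e3 e1 e2
    have hic : IntervalIntegrable (fun τ => B (f (P (u τ))) (fderiv ℝ P (u τ) (f (u τ))))
        MeasureTheory.volume 1 T := by
      refine ContinuousOn.intervalIntegrable ?_
      have hm : Set.uIcc 1 T ⊆ Set.Ioi 0 := fun τ hτ => by
        rw [Set.uIcc_of_le hT] at hτ
        exact one_pos.trans_le hτ.1
      have hu' := hucont.mono hm
      exact (B.continuous.comp_continuousOn (hf.continuous.comp_continuousOn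
        (hPc.continuous.comp_continuousOn hu'))).clm_apply
        ((hcdP.comp_continuousOn hu').clm_apply (hf.continuous.comp_continuousOn hu'))
    have heq : ∫ τ in (1 : ℝ)..T, B (f (G (0, τ))) (fderiv ℝ G (0, τ) (0, 1)) =
        ∫ τ in (1 : ℝ)..T, B (f (P (u τ))) (fderiv ℝ P (u τ) (f (u τ))) := by
      refine intervalIntegral.integral_congr fun τ hτ => ?_
      rw [Set.uIcc_of_le hT] at hτ
      simp only [hG0 τ (one_pos.trans_le hτ.1)]
      simp only [hGdef, hh0]
    have hint' : IntervalIntegrable (fun τ => ‖f (u (τ + t))‖ ^ 2) MeasureTheory.volume 1 T := by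
      refine ContinuousOn.intervalIntegrable (hφcont.comp (continuous_add_const t).continuousOn fun τ hτ => ?_)
      rw [Set.uIcc_of_le hT] at hτ
      exact add_pos (one_pos.trans_le hτ.1) ht
    rw [heq]
    refine le_trans ?_ (intervalIntegral.integral_mono_on hT
      (hint'.sub ((hint 1 T one_pos hT0).const_mul _)) hic hpt)
    rw [intervalIntegral.integral_sub hint' ((hint 1 T one_pos hT0).const_mul _),
      intervalIntegral.integral_const_mul,
      intervalIntegral.integral_comp_add_right (fun τ => ‖f (u τ)‖ ^ 2) t, ← hI]
    have k1 := intervalIntegral.integral_add_adjacent_intervals (hint 1 T one_pos hT0)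
      (hint T (T + t) hT0 (by linarith))
    have k2 := intervalIntegral.integral_add_adjacent_intervals
      (hint 1 (1 + t) one_pos (by linarith)) (hint (1 + t) (T + t) (by linarith) (by linarith))
    have k3 : 0 ≤ ∫ τ in T..(T + t), ‖f (u τ)‖ ^ 2 :=
      intervalIntegral.integral_nonneg (by linarith) fun τ _ => sq_nonneg _
    linarith
  have b1 := abs_le.1 (hM₁ T hT)
  have b2 := abs_le.1 (hM₂ T hT0)
  have b3 := abs_le.1 (hM₂ 1 one_pos)
  have b4 := abs_le.1 harea
  rw [stokes] at b4
  linarith [b1.2, b2.1, b3.2, b4.1, b4.2]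

theorem area_quadratic_form_le {A m d n₁ n₂ X Y Z : ℝ} (hA : 0 < A) :
    2 * m * (-(m + d) * Z ^ 2 + 2 * n₁ * Z * X + 2 * n₂ * Z * Y -
      (m - d) * A * X ^ 2 - (m - d) * A * Y ^ 2) * A ≤
      -(A * (m ^ 2 - d ^ 2) - n₁ ^ 2 - n₂ ^ 2) * (Z ^ 2 + A * (Y ^ 2 + X ^ 2)) := by
  have h1 := sq_nonneg (m * Z + d * Z - n₁ * X - n₂ * Y)
  have h2 := sq_nonneg (A * (m - d) * X - n₁ * Z)
  have h3 := sq_nonneg (A * (m - d) * Y - n₂ * Z)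
  have h4 := sq_nonneg (n₁ * Y - n₂ * X)
  have h5 := mul_nonneg hA.le h1
  have h6 := mul_nonneg hA.le h4
  linarith

theorem lyapunov_coefficient_lower_bound {σ b : ℝ} (hb : 0 < b) (hb4 : b ≤ 4) (h : b < 2 * σ) :
    b ^ 2 * (3 * σ + 1 - b) * (σ + b + 1) ≤
      (2 + b) * ((4 + 6 * b) * σ ^ 2 + (b + b ^ 2 / 4) * σ - 9 * b ^ 3 / 16) := by
  obtain ⟨τ, rfl⟩ : ∃ τ, σ = b / 2 + τ := ⟨σ - b / 2, by ring⟩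
  have hτ : 0 < τ := by linarith
  have h4 : 0 ≤ 4 - b := by linarith
  nlinarith [mul_pos hb hτ, mul_nonneg (mul_pos hb hτ).le h4, mul_nonneg hb.le h4, mul_nonneg (mul_pos hb hb).le h4, mul_nonneg (mul_pos hb (mul_pos hb hb)).le h4, mul_nonneg (mul_pos hb (mul_pos hb hτ)).le h4,mul_nonneg (mul_pos hτ (mul_pos hb hτ)).le h4, mul_nonneg (mul_pos hb (mul_pos hb (mul_pos hτ hτ))).le h4, mul_pos hb hb, mul_pos hτ hτ, mul_pos hb (mul_pos hτ hτ),mul_pos hb (mul_pos hb (mul_pos hτ hτ)), mul_pos hb (mul_pos hb hτ), mul_pos hb (mul_pos hb (mul_pos hb hτ)), mul_pos hb (mul_pos hb hb)]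

theorem lyapunov_coefficient_lower_bound_of_lt_one {σ b : ℝ} (hb : 0 < b) (hb1 : b ≤ 1)
    (h : b < 2 * σ) :
    b * (σ + b + 1) * (σ + b / 2) ≤
      (4 + 6 * b) * σ ^ 2 + (b + b ^ 2 / 4) * σ - 9 * b ^ 3 / 16 := by
  obtain ⟨τ, rfl⟩ : ∃ τ, σ = b / 2 + τ := ⟨σ - b / 2, by ring⟩
  have hτ : 0 < τ := by linarith
  have h4 : 0 ≤ 1 - b := by linarith
  nlinarith [mul_pos hb hτ, mul_nonneg (mul_pos hb hτ).le h4, mul_nonneg hb.le h4, mul_nonneg (mul_pos hb hb).le h4, mul_pos hb hb, mul_pos hτ hτ, mul_pos hb (mul_pos hτ hτ), mul_pos hb (mul_pos hb hτ)]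

/-- A polynomial Lyapunov-type function for the Lorenz system, written in the coordinates
`x`, `v = σ (y - x)`, `w = z - x ^ 2 / (2 σ)`. -/
theorem exists_lyapunov_polynomial {σ b r ρ g : ℝ} (hσ : 0 < σ) (hb : 0 < b) (hb4 : b ≤ 4)
    (h : b < 2 * σ) (hr : r < (σ + b) * (b + 1) / σ)
    (hρ : σ * ρ = (1 + 7 * b / 4) * (σ + b / 4)) (hg : σ * g = σ + 3 * b / 4) :
    ∃ p₁ p₂ p₃ p₄ p₅ p₆ p₇ : ℝ, ∀ x v w,
      2 * p₁ * (x * v) + p₂ * (v * v + x * (-(σ + 1) * v + σ * (r - 1) * x - x ^ 3 / 2 - σ * x * w))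
      + 2 * p₃ * v * (-(σ + 1) * v + σ * (r - 1) * x - x ^ 3 / 2 - σ * x * w)
      + p₄ * (-b * w + (1 - b / (2 * σ)) * x ^ 2)
      + 2 * p₅ * w * (-b * w + (1 - b / (2 * σ)) * x ^ 2)
      + p₆ * (2 * x * v * w + x ^ 2 * (-b * w + (1 - b / (2 * σ)) * x ^ 2))
      + p₇ * (4 * x ^ 3 * v) ≤
      4 * ρ * (w + x ^ 2 / (2 * σ)) - (w + x ^ 2 / (2 * σ)) ^ 2 - (g * x + v / σ) ^ 2 := by
  set N := (4 + 6 * b) * σ ^ 2 + (b + b ^ 2 / 4) * σ - 9 * b ^ 3 / 16 with hN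
  have hL := lyapunov_coefficient_lower_bound hb hb4 h
  rw [← hN] at hL
  have hs : 0 < σ + b + 1 := by positivity
  set p₂ := N / (b ^ 2 * σ ^ 2 * (σ + b + 1)) with hp₂
  have hp₂N : p₂ * (b ^ 2 * σ ^ 2 * (σ + b + 1)) = N := by rw [hp₂]; field_simp
  set k := 1 - b / (2 * σ) with hk
  have hkσ : σ * k = σ - b / 2 := by rw [hk]; field_simp
  have hk0 : 0 < k := by
    have : 0 < σ * k := by linarith
    exact (mul_pos_iff_of_pos_left hσ).1 this
  -- the lower bound on the main coefficient
  have hp₂L : 3 * σ + 1 - b ≤ p₂ * σ ^ 2 * (2 + b) := by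
    have : (3 * σ + 1 - b) * (b ^ 2 * (σ + b + 1)) ≤
        (p₂ * σ ^ 2 * (2 + b)) * (b ^ 2 * (σ + b + 1)) := by
      calc _ = b ^ 2 * (3 * σ + 1 - b) * (σ + b + 1) := by ring
        _ ≤ (2 + b) * N := hL
        _ = _ := by rw [← hp₂N]; ring
    exact le_of_mul_le_mul_right this (by positivity)
  have hp₂0 : 0 ≤ p₂ := by
    have hN0 : 0 ≤ N := by
      have : 0 ≤ b ^ 2 * (3 * σ + 1 - b) * (σ + b + 1) := by
        have : 0 ≤ 3 * σ + 1 - b := by linarith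
        positivity
      have := this.trans hL
      exact nonneg_of_mul_nonneg_right this (by positivity)
    positivity
  set p₃ := (p₂ + 1 / σ ^ 2) / (2 * (σ + 1)) with hp₃
  have hp₃e : 2 * (σ + 1) * p₃ = p₂ + 1 / σ ^ 2 := by rw [hp₃]; field_simp
  have hp₃0 : 0 ≤ p₃ := by positivity
  set p₅ := (p₂ * σ + p₃ * σ * b - 1 / σ) / (2 * k) with hp₅
  have hp₅e : 2 * k * p₅ = p₂ * σ + p₃ * σ * b - 1 / σ := by rw [hp₅]; field_simp
  clear_value N p₂ k p₃ p₅
  -- nonnegativity of the three coefficients of the difference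
  have hα : 0 ≤ 4 * ρ / b - g ^ 2 - p₂ * σ * (r - 1) := by
    have h1 : σ * (r - 1) ≤ b * (σ + b + 1) := by
      rw [lt_div_iff₀ hσ] at hr
      linarith
    have h2 : 4 * ρ / b - g ^ 2 = p₂ * (b * (σ + b + 1)) := by
      have hρ' : ρ = (1 + 7 * b / 4) * (σ + b / 4) / σ := by field_simp; linarith
      have hg' : g = (σ + 3 * b / 4) / σ := by field_simp; linarith
      rw [hρ', hg', hp₂, hN]
      field_simp
      ring
    have h3 := mul_le_mul_of_nonneg_left h1 hp₂0
    linarith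
  have hβ : 0 ≤ p₂ / 2 - p₃ * σ * k - 1 / (4 * σ ^ 2) := by
    have h1 : (p₂ / 2 - p₃ * σ * k - 1 / (4 * σ ^ 2)) * (4 * (σ + 1) * σ ^ 2) =
        p₂ * σ ^ 2 * (2 + b) - (3 * σ + 1 - b) := by
      have h2 : p₃ * σ * k = p₃ * (σ - b / 2) := by rw [mul_assoc, hkσ]
      rw [h2, hp₃]
      field_simp
      ring
    have h2 : 0 ≤ (p₂ / 2 - p₃ * σ * k - 1 / (4 * σ ^ 2)) * (4 * (σ + 1) * σ ^ 2) := by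
      rw [h1]; linarith
    exact nonneg_of_mul_nonneg_left h2 (by positivity)
  have hγ : 0 ≤ 2 * p₅ * b - 1 := by
    have h1 : (2 * p₅ * b - 1) * (σ * k) = b * (p₂ * σ ^ 2 + p₃ * σ ^ 2 * b - 1) - (σ - b / 2) := by
      have : 2 * k * p₅ * σ = p₂ * σ ^ 2 + p₃ * σ ^ 2 * b - 1 := by
        rw [hp₅e]; field_simp
      rw [← this, ← hkσ]; ring
    have h2 : 0 ≤ (2 * p₅ * b - 1) * (σ * k) := by
      rw [h1]
      rcases le_total b 1 with hb1 | hb1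
      · have h3 := lyapunov_coefficient_lower_bound_of_lt_one hb hb1 h
        rw [← hN, ← hp₂N] at h3
        have h4 : σ + b / 2 ≤ p₂ * b * σ ^ 2 :=
          le_of_mul_le_mul_left (a := b * (σ + b + 1)) (by linarith) (by positivity)
        have : 0 ≤ p₃ * σ ^ 2 * b * b := by positivity
        nlinarith
      · have h3 : 3 ≤ 2 * (2 + b) * (p₃ * σ ^ 2) := by
          have h5 : 2 * (σ + 1) * (p₃ * σ ^ 2) = p₂ * σ ^ 2 + 1 := by
            rw [← mul_assoc, hp₃e]; field_simp
          have : (σ + 1) * 3 ≤ (σ + 1) * (2 * (2 + b) * (p₃ * σ ^ 2)) := by nlinarith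
          exact le_of_mul_le_mul_left this (by positivity)
        have h4 : 0 ≤ (2 + b) * (b * (p₂ * σ ^ 2 + p₃ * σ ^ 2 * b - 1) - (σ - b / 2)) := by
          have e1 := mul_le_mul_of_nonneg_left h3 (sq_nonneg b)
          have e2 := mul_le_mul_of_nonneg_left hp₂L hb.le
          have e3 := mul_nonneg hσ.le (sub_nonneg.2 hb1)
          linarith
        exact nonneg_of_mul_nonneg_right h4 (by positivity)
    exact nonneg_of_mul_nonneg_left h2 (by positivity)
  refine ⟨(p₂ * (σ + 1) - 2 * p₃ * σ * (r - 1) - 2 * g / σ) / 2, p₂, p₃, -(4 * ρ / b), p₅,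
    p₃ * σ, p₃ / 4, fun x v w => ?_⟩
  have hp₂e : p₂ = 2 * (σ + 1) * p₃ - 1 / σ ^ 2 := by linarith
  have hid : 4 * ρ * (w + x ^ 2 / (2 * σ)) - (w + x ^ 2 / (2 * σ)) ^ 2 - (g * x + v / σ) ^ 2 -
      (2 * ((p₂ * (σ + 1) - 2 * p₃ * σ * (r - 1) - 2 * g / σ) / 2) * (x * v) +
        p₂ * (v * v + x * (-(σ + 1) * v + σ * (r - 1) * x - x ^ 3 / 2 - σ * x * w))
      + 2 * p₃ * v * (-(σ + 1) * v + σ * (r - 1) * x - x ^ 3 / 2 - σ * x * w)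
      + -(4 * ρ / b) * (-b * w + k * x ^ 2)
      + 2 * p₅ * w * (-b * w + k * x ^ 2)
      + p₃ * σ * (2 * x * v * w + x ^ 2 * (-b * w + k * x ^ 2))
      + p₃ / 4 * (4 * x ^ 3 * v)) =
      (4 * ρ / b - g ^ 2 - p₂ * σ * (r - 1)) * x ^ 2
      + (p₂ / 2 - p₃ * σ * k - 1 / (4 * σ ^ 2)) * (x ^ 2) ^ 2 + (2 * p₅ * b - 1) * w ^ 2
      + (p₂ * σ + p₃ * σ * b - 1 / σ - 2 * k * p₅) * (x ^ 2 * w)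
      + (2 * (σ + 1) * p₃ - p₂ - 1 / σ ^ 2) * v ^ 2 := by
    rw [hk]
    field_simp
    ring
  rw [← hp₅e] at hid
  have e1 := mul_nonneg hα (sq_nonneg x)
  have e2 := mul_nonneg hβ (sq_nonneg (x ^ 2))
  have e3 := mul_nonneg hγ (sq_nonneg w)
  rw [hp₃e] at hid
  linarith

/-- A function that strictly decreases at parameter zero, uniformly over a compact set,
decreases at a linear rate for small positive parameters. -/
theorem exists_linear_decay_of_hasDerivAt_neg {X : Type*} [NormedAddCommGroup X] [NormedSpace ℝ X]
    {g : ℝ × X → ℝ} (hg : ContDiff ℝ 1 g) {S : Set X} (hS : IsCompact S)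
    (hneg : ∀ s ∈ S, ∃ d < 0, HasDerivAt (fun ε => g (ε, s)) d 0) :
    ∃ c > 0, ∃ ε₀ > 0, ∀ ε ∈ Set.Icc 0 ε₀, ∀ s ∈ S, g (ε, s) ≤ g (0, s) - c * ε := by
  set g' : ℝ × X → ℝ := fun p => fderiv ℝ g p (1, 0) with hg'
  have hder : ∀ ε s, HasDerivAt (fun ε => g (ε, s)) (g' (ε, s)) ε := fun ε s =>
    ((hg.differentiable (by norm_num)) (ε, s)).hasFDerivAt.comp_hasDerivAt ε
      ((hasDerivAt_id ε).prodMk (hasDerivAt_const ε s))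
  have hcont : Continuous g' :=
    (hg.continuous_fderiv (by norm_num)).clm_apply continuous_const
  have hneg' : ∀ s ∈ S, g' (0, s) < 0 := fun s hs => by
    obtain ⟨d, hd, h⟩ := hneg s hs
    rwa [(hder 0 s).unique h]
  obtain ⟨c, hc, hcS⟩ : ∃ c > 0, ∀ s ∈ S, g' (0, s) < -c := by
    rcases S.eq_empty_or_nonempty with rfl | hne
    · exact ⟨1, one_pos, by simp⟩
    · obtain ⟨s₀, hs₀, hmax⟩ := hS.exists_isMaxOn hne
        (hcont.comp (continuous_const.prodMk continuous_id : Continuous fun s : X => ((0 : ℝ), s))).continuousOn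
      have h0 := hneg' s₀ hs₀
      refine ⟨-g' (0, s₀) / 2, by linarith, fun s hs => ?_⟩
      have : g' (0, s) ≤ g' (0, s₀) := hmax hs
      linarith
  have hopen : IsOpen {p : ℝ × X | g' p < -c} := isOpen_lt hcont continuous_const
  obtain ⟨U, V, hU, -, h0U, hSV, hUV⟩ := generalized_tube_lemma (isCompact_singleton (x := (0 : ℝ)))
    hS hopen (by rintro ⟨a, s⟩ ⟨ha, hs⟩; obtain rfl : a = 0 := ha; exact hcS s hs)
  obtain ⟨δ, hδ, hball⟩ := Metric.isOpen_iff.1 hU 0 (h0U rfl)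
  refine ⟨c, hc, δ / 2, by positivity, fun ε hε s hs => ?_⟩
  have hanti : AntitoneOn (fun t => g (t, s) + c * t) (Set.Icc 0 (δ / 2)) := by
    refine antitoneOn_of_hasDerivWithinAt_nonpos (f' := fun t => g' (t, s) + c * 1)
      (convex_Icc _ _) (fun t _ => ?_) (fun t _ => ?_) (fun t ht => ?_)
    · exact ((hder t s).add ((hasDerivAt_id t).const_mul c)).continuousAt.continuousWithinAt
    · exact ((hder t s).add ((hasDerivAt_id t).const_mul c)).hasDerivWithinAt
    · rw [interior_Icc] at ht
      have hm : (t, s) ∈ U ×ˢ V := ⟨hball (by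
        rw [Metric.mem_ball, Real.dist_eq, abs_lt]
        constructor <;> linarith [ht.1, ht.2]), hSV hs⟩
      have : g' (t, s) < -c := hUV hm
      linarith
  have := hanti ⟨le_rfl, by positivity⟩ hε hε.1
  simp only [mul_zero, add_zero] at this
  linarith

/-- The vector field of the Lorenz system. -/
def lorenzField (σ b r : ℝ) (p : ℝ × ℝ × ℝ) : ℝ × ℝ × ℝ :=
  (-σ * (p.1 - p.2.1), r * p.1 - p.2.1 - p.1 * p.2.2, -b * p.2.2 + p.1 * p.2.1)

theorem contDiff_lorenzField (σ b r : ℝ) {k : WithTop ℕ∞} : ContDiff ℝ k (lorenzField σ b r) := by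
  unfold lorenzField
  fun_prop

theorem fderiv_lorenzField_apply (σ b r : ℝ) (v p : ℝ × ℝ × ℝ) :
    fderiv ℝ (lorenzField σ b r) v p = (-σ * (p.1 - p.2.1),
      (r - v.2.2) * p.1 - p.2.1 - v.1 * p.2.2, v.2.1 * p.1 + v.1 * p.2.1 - b * p.2.2) := by
  have h1 : HasFDerivAt (fun v : ℝ × ℝ × ℝ => v.1) (ContinuousLinearMap.fst ℝ ℝ (ℝ × ℝ)) v :=
    hasFDerivAt_fst
  have h2 : HasFDerivAt (fun v : ℝ × ℝ × ℝ => v.2) (ContinuousLinearMap.snd ℝ ℝ (ℝ × ℝ)) v :=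
    hasFDerivAt_snd
  have h3 := h2.fst
  have h4 := h2.snd
  have h : HasFDerivAt (lorenzField σ b r) _ v :=
    ((h1.sub h3).const_mul (-σ)).prodMk ((((h1.const_mul r).sub h3).sub (h1.mul h4)).prodMk
      ((h4.const_mul (-b)).add (h1.mul h3)))
  rw [h.fderiv]
  refine Prod.ext ?_ (Prod.ext ?_ ?_)
  · simp
  · simp; ring
  · simp; ring

/-- The `2 × 2` minors of a pair of vectors. -/
def minors (p q : ℝ × ℝ × ℝ) : ℝ × ℝ × ℝ :=
  (p.1 * q.2.1 - p.2.1 * q.1, p.1 * q.2.2 - p.2.2 * q.1, p.2.1 * q.2.2 - p.2.2 * q.2.1)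

/-- The quadratic form measuring areas in the Lorenz system. -/
def areaForm (A c : ℝ) (m : ℝ × ℝ × ℝ) : ℝ :=
  (m.2.2 - c * m.2.1) ^ 2 + A * (m.1 ^ 2 + m.2.1 ^ 2)

/-- The action on minors of one linearised Euler step of the Lorenz system. -/
def minorStep (σ b r ε : ℝ) (v m : ℝ × ℝ × ℝ) : ℝ × ℝ × ℝ :=
  (m.1 + ε * (-(σ + 1) * m.1 - v.1 * m.2.1) +
    ε ^ 2 * ((σ - σ * (r - v.2.2)) * m.1 + σ * v.1 * m.2.1 - σ * v.1 * m.2.2),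
  m.2.1 + ε * (v.1 * m.1 - (σ + b) * m.2.1 + σ * m.2.2) +
    ε ^ 2 * ((-(σ * v.1) - σ * v.2.1) * m.1 + σ * b * m.2.1 - σ * b * m.2.2),
  m.2.2 + ε * (-(v.2.1 * m.1) + (r - v.2.2) * m.2.1 - (1 + b) * m.2.2) +
    ε ^ 2 * (((r - v.2.2) * v.1 + v.2.1) * m.1 + (v.1 * v.2.1 - b * (r - v.2.2)) * m.2.1 +
      (b + v.1 ^ 2) * m.2.2))

theorem minors_add_smul_fderiv_lorenzField (σ b r ε : ℝ) (v p q : ℝ × ℝ × ℝ) :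
    minors (p + ε • fderiv ℝ (lorenzField σ b r) v p) (q + ε • fderiv ℝ (lorenzField σ b r) v q) =
      minorStep σ b r ε v (minors p q) := by
  rw [fderiv_lorenzField_apply, fderiv_lorenzField_apply]
  simp only [minors, minorStep, Prod.fst_add, Prod.snd_add, Prod.smul_fst, Prod.smul_snd,
    smul_eq_mul]
  refine Prod.ext ?_ (Prod.ext ?_ ?_) <;> simp only <;> ring

theorem minorStep_smul (σ b r ε a : ℝ) (v m : ℝ × ℝ × ℝ) :
    minorStep σ b r ε v (a • m) = a • minorStep σ b r ε v m := by
  simp only [minorStep, Prod.smul_mk, Prod.smul_fst, Prod.smul_snd, smul_eq_mul]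
  refine Prod.ext ?_ (Prod.ext ?_ ?_) <;> simp only <;> ring

theorem areaForm_smul (A c a : ℝ) (m : ℝ × ℝ × ℝ) : areaForm A c (a • m) = a ^ 2 * areaForm A c m := by
  simp only [areaForm, Prod.smul_fst, Prod.smul_snd, smul_eq_mul]
  ring

theorem continuous_areaForm (A c : ℝ) : Continuous (areaForm A c) := by
  unfold areaForm
  fun_prop

theorem areaForm_nonneg {A : ℝ} (hA : 0 ≤ A) (c : ℝ) (m : ℝ × ℝ × ℝ) : 0 ≤ areaForm A c m := by
  unfold areaForm
  positivity

theorem sq_norm_le_mul_areaForm {A : ℝ} (hA : 0 < A) (c : ℝ) (m : ℝ × ℝ × ℝ) :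
    ‖m‖ ^ 2 ≤ (2 + (1 + 2 * c ^ 2) / A) * areaForm A c m := by
  have h1 : m.1 ^ 2 + m.2.1 ^ 2 ≤ areaForm A c m / A := by
    rw [le_div_iff₀ hA]
    unfold areaForm
    linarith [sq_nonneg (m.2.2 - c * m.2.1)]
  have h0 := areaForm_nonneg hA.le c m
  have h2 : m.2.2 ^ 2 ≤ 2 * areaForm A c m + 2 * c ^ 2 * (areaForm A c m / A) := by
    have h3 : (m.2.2 - c * m.2.1) ^ 2 ≤ areaForm A c m := by
      unfold areaForm
      have : 0 ≤ A * (m.1 ^ 2 + m.2.1 ^ 2) := by positivity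
      linarith
    have h4 : c ^ 2 * (m.1 ^ 2 + m.2.1 ^ 2) ≤ c ^ 2 * (areaForm A c m / A) := by gcongr
    nlinarith [sq_nonneg (m.2.2 - 2 * (c * m.2.1)), mul_nonneg (sq_nonneg c) (sq_nonneg m.1)]
  have h5 : (2 + (1 + 2 * c ^ 2) / A) * areaForm A c m =
      2 * areaForm A c m + areaForm A c m / A + 2 * c ^ 2 * (areaForm A c m / A) := by ring
  have h6 : 0 ≤ areaForm A c m / A := by positivity
  have h7 : 0 ≤ 2 * c ^ 2 * (areaForm A c m / A) := by positivity
  rw [h5]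
  have hn : ‖m‖ = max |m.1| (max |m.2.1| |m.2.2|) := rfl
  rw [hn]
  rcases max_choice |m.1| (max |m.2.1| |m.2.2|) with h | h
  · rw [h, sq_abs]
    linarith [sq_nonneg m.2.1]
  · rw [h]
    rcases max_choice |m.2.1| |m.2.2| with h | h <;> rw [h, sq_abs] <;>
      linarith [sq_nonneg m.1]

theorem hasDerivAt_polynomial {x v w : ℝ → ℝ} {x' v' w' t : ℝ} (hx : HasDerivAt x x' t)
    (hv : HasDerivAt v v' t) (hw : HasDerivAt w w' t) (p₁ p₂ p₃ p₄ p₅ p₆ p₇ : ℝ) :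
    HasDerivAt (fun t => p₁ * x t ^ 2 + p₂ * (x t * v t) + p₃ * v t ^ 2 + p₄ * w t +
      p₅ * w t ^ 2 + p₆ * (x t ^ 2 * w t) + p₇ * x t ^ 4)
      (2 * p₁ * (x t * x') + p₂ * (x' * v t + x t * v') + 2 * p₃ * v t * v' + p₄ * w'
      + 2 * p₅ * w t * w' + p₆ * (2 * x t * x' * w t + x t ^ 2 * w')
      + p₇ * (4 * x t ^ 3 * x')) t := by
  have h := (((((((hx.pow 2).const_mul p₁).add ((hx.mul hv).const_mul p₂)).add
    ((hv.pow 2).const_mul p₃)).add (hw.const_mul p₄)).add ((hw.pow 2).const_mul p₅)).add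
    (((hx.pow 2).mul hw).const_mul p₆)).add ((hx.pow 4).const_mul p₇)
  refine (h.congr_deriv ?_)
  simp
  ring

theorem areaForm_minorStep_hasDerivAt (σ b r A c : ℝ) (v m : ℝ × ℝ × ℝ) :
    HasDerivAt (fun ε => areaForm A c (minorStep σ b r ε v m))
      (2 * (m.2.2 - c * m.2.1) * ((-(v.2.1 * m.1) + (r - v.2.2) * m.2.1 - (1 + b) * m.2.2) -
        c * (v.1 * m.1 - (σ + b) * m.2.1 + σ * m.2.2)) +
      A * (2 * m.1 * (-(σ + 1) * m.1 - v.1 * m.2.1) +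
        2 * m.2.1 * (v.1 * m.1 - (σ + b) * m.2.1 + σ * m.2.2))) 0 := by
  have h : ∀ a b c : ℝ, HasDerivAt (fun ε : ℝ => a + ε * b + ε ^ 2 * c) b 0 := fun a b c => by
    have := (((hasDerivAt_id (0 : ℝ)).mul_const b).const_add a).add
      (((hasDerivAt_id (0 : ℝ)).pow 2).mul_const c)
    exact this.congr_deriv (by simp)
  have h1 := h m.1 (-(σ + 1) * m.1 - v.1 * m.2.1)
    ((σ - σ * (r - v.2.2)) * m.1 + σ * v.1 * m.2.1 - σ * v.1 * m.2.2)
  have h2 := h m.2.1 (v.1 * m.1 - (σ + b) * m.2.1 + σ * m.2.2)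
    ((-(σ * v.1) - σ * v.2.1) * m.1 + σ * b * m.2.1 - σ * b * m.2.2)
  have h3 := h m.2.2 (-(v.2.1 * m.1) + (r - v.2.2) * m.2.1 - (1 + b) * m.2.2)
    (((r - v.2.2) * v.1 + v.2.1) * m.1 + (v.1 * v.2.1 - b * (r - v.2.2)) * m.2.1 +
      (b + v.1 ^ 2) * m.2.2)
  have h4 := ((h3.sub (h2.const_mul c)).pow 2).add (((h1.pow 2).add (h2.pow 2)).const_mul A)
  refine h4.congr_deriv ?_
  simp

/-- Uniform contraction of a two-dimensional area by the Euler steps of the Lorenz system. -/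
theorem lorenz_area_contraction {σ b r : ℝ} (hσ : 0 < σ) (hb : 0 < b) (hb4 : b ≤ 4)
    (h : b < 2 * σ) (hr : r < (σ + b) * (b + 1) / σ) {K : Set (ℝ × ℝ × ℝ)} (hK : IsCompact K) :
    ∃ (W : ℝ × ℝ × ℝ → ℝ) (A a : ℝ), Continuous W ∧ 0 < A ∧ ∃ c > 0, ∃ ε₀ > 0,
      ∀ ε ∈ Set.Icc 0 ε₀, ∀ v ∈ K, ∀ m,
        Real.exp (W (v + ε • lorenzField σ b r v)) * areaForm A a (minorStep σ b r ε v m) ≤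
          (1 - c * ε) * (Real.exp (W v) * areaForm A a m) := by
  set e := 3 * b / 4 with he
  set a := e / σ with ha
  set ρs := (1 + 7 * b / 4) * (σ + b / 4) / σ with hρs
  have hρs' : σ * ρs = (1 + 7 * b / 4) * (σ + b / 4) := by rw [hρs]; field_simp
  have haσ : σ * a = e := by rw [ha]; field_simp
  set ρ := r - a * (1 - σ + e) with hρ
  have hρlt : ρ < ρs := by
    rw [lt_div_iff₀ hσ] at hr
    have : σ * ρ < σ * ρs := by
      rw [hρs', hρ]
      have : σ * (r - a * (1 - σ + e)) = r * σ - e * (1 - σ + e) := by rw [← haσ]; ring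
      rw [this, he]
      linarith
    exact lt_of_mul_lt_mul_left this hσ.le
  have hρs0 : 0 < ρs := by positivity
  set A := (2 * ρs - ρ) / σ with hA
  have hAσ : σ * A = 2 * ρs - ρ := by rw [hA]; field_simp
  have hA0 : 0 < A := div_pos (by linarith) hσ
  obtain ⟨p₁, p₂, p₃, p₄, p₅, p₆, p₇, hW⟩ := exists_lyapunov_polynomial (ρ := ρs) (g := 1 + a)
    hσ hb hb4 h hr hρs' (by rw [mul_add, haσ, he]; ring)
  set ms := σ + 1 + 2 * b with hms
  have hms0 : 0 < ms := by positivity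
  set κ := 1 / (2 * ms * A) with hκ
  set W : ℝ × ℝ × ℝ → ℝ := fun p => κ * (p₁ * p.1 ^ 2 + p₂ * (p.1 * (σ * (p.2.1 - p.1))) +
      p₃ * (σ * (p.2.1 - p.1)) ^ 2 + p₄ * (p.2.2 - p.1 ^ 2 / (2 * σ)) +
      p₅ * (p.2.2 - p.1 ^ 2 / (2 * σ)) ^ 2 + p₆ * (p.1 ^ 2 * (p.2.2 - p.1 ^ 2 / (2 * σ))) +
      p₇ * p.1 ^ 4) with hWdef
  have hWc : Continuous W := by fun_prop
  refine ⟨W, A, a, hWc, hA0, ?_⟩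
  set S : Set ((ℝ × ℝ × ℝ) × (ℝ × ℝ × ℝ)) := K ×ˢ {m | areaForm A a m = 1} with hS
  have hScpt : IsCompact S := by
    refine hK.prod (Metric.isCompact_of_isClosed_isBounded
      (isClosed_singleton.preimage (continuous_areaForm A a)) ?_)
    refine (Metric.isBounded_closedBall (x := 0)
      (r := 2 + (1 + 2 * a ^ 2) / A + 1)).subset fun m hm => ?_
    have hm1 : areaForm A a m = 1 := hm
    have := sq_norm_le_mul_areaForm hA0 a m
    rw [hm1, mul_one] at this
    rw [mem_closedBall_zero_iff]
    nlinarith [norm_nonneg m]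
  set g : ℝ × ((ℝ × ℝ × ℝ) × (ℝ × ℝ × ℝ)) → ℝ := fun s =>
    Real.exp (W (s.2.1 + s.1 • lorenzField σ b r s.2.1)) *
      areaForm A a (minorStep σ b r s.1 s.2.1 s.2.2) with hg
  have hgc : ContDiff ℝ 1 g := by
    simp only [hg, hWdef, areaForm, minorStep, lorenzField, Prod.fst_add, Prod.snd_add,
      Prod.smul_fst, Prod.smul_snd, smul_eq_mul]
    fun_prop
  have hneg : ∀ s ∈ S, ∃ d < 0, HasDerivAt (fun ε => g (ε, s)) d 0 := by
    rintro ⟨v, m⟩ ⟨-, hm⟩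
    have hm1 : areaForm A a m = 1 := hm
    have hlin : ∀ y y' : ℝ, HasDerivAt (fun ε : ℝ => y + ε * y') y' 0 := fun y y' => by
      have := ((hasDerivAt_id (0 : ℝ)).mul_const y').const_add y
      exact this.congr_deriv (by simp)
    set F := lorenzField σ b r v with hF
    have hx := hlin v.1 F.1
    have hy := hlin v.2.1 F.2.1
    have hz := hlin v.2.2 F.2.2
    have hWd := (hasDerivAt_polynomial hx ((hy.sub hx).const_mul σ)
      (hz.sub ((hx.pow 2).div_const (2 * σ))) p₁ p₂ p₃ p₄ p₅ p₆ p₇).const_mul κ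
    have hQd := areaForm_minorStep_hasDerivAt σ b r A a v m
    set L := 2 * p₁ * (v.1 * (σ * (v.2.1 - v.1))) + p₂ * (σ * (v.2.1 - v.1) * (σ * (v.2.1 - v.1)) +
        v.1 * (-(σ + 1) * (σ * (v.2.1 - v.1)) + σ * (r - 1) * v.1 - v.1 ^ 3 / 2 -
          σ * v.1 * (v.2.2 - v.1 ^ 2 / (2 * σ))))
      + 2 * p₃ * (σ * (v.2.1 - v.1)) * (-(σ + 1) * (σ * (v.2.1 - v.1)) + σ * (r - 1) * v.1 -
        v.1 ^ 3 / 2 - σ * v.1 * (v.2.2 - v.1 ^ 2 / (2 * σ)))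
      + p₄ * (-b * (v.2.2 - v.1 ^ 2 / (2 * σ)) + (1 - b / (2 * σ)) * v.1 ^ 2)
      + 2 * p₅ * (v.2.2 - v.1 ^ 2 / (2 * σ)) *
        (-b * (v.2.2 - v.1 ^ 2 / (2 * σ)) + (1 - b / (2 * σ)) * v.1 ^ 2)
      + p₆ * (2 * v.1 * (σ * (v.2.1 - v.1)) * (v.2.2 - v.1 ^ 2 / (2 * σ)) +
        v.1 ^ 2 * (-b * (v.2.2 - v.1 ^ 2 / (2 * σ)) + (1 - b / (2 * σ)) * v.1 ^ 2))
      + p₇ * (4 * v.1 ^ 3 * (σ * (v.2.1 - v.1))) with hL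
    have hLle : L ≤ 4 * ρs * v.2.2 - v.2.2 ^ 2 - (v.2.1 + a * v.1) ^ 2 := by
      refine (hW v.1 (σ * (v.2.1 - v.1)) (v.2.2 - v.1 ^ 2 / (2 * σ))).trans_eq ?_
      field_simp
      ring
    have hWd' : HasDerivAt (fun ε : ℝ => W (v + ε • F)) (κ * L) 0 := by
      refine HasDerivAt.congr_deriv hWd ?_
      rw [hL, hF]
      simp only [lorenzField, zero_mul, add_zero, Pi.pow_apply, Pi.sub_apply]
      congr 1
      field_simp
      ring
    refine ⟨_, ?_, hWd'.exp.mul hQd⟩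
    have hquad := area_quadratic_form_le (m := ms) (d := 1 - σ + 2 * e) (n₁ := 2 * ρs - v.2.2)
      (n₂ := -(v.2.1 + a * v.1)) (X := m.2.1) (Y := m.1) (Z := m.2.2 - a * m.2.1) hA0
    rw [show (m.2.2 - a * m.2.1) ^ 2 + A * (m.1 ^ 2 + m.2.1 ^ 2) = 1 from hm1, mul_one] at hquad
    have hAm : A * (ms ^ 2 - (1 - σ + 2 * e) ^ 2) = 4 * ρs * (2 * ρs - ρ) := by
      have : ms ^ 2 - (1 - σ + 2 * e) ^ 2 = 4 * (σ * ρs) := by rw [hρs', hms, he]; ring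
      rw [this, ← hAσ]
      ring
    rw [hAm] at hquad
    set Q' := 2 * (m.2.2 - a * m.2.1) * ((-(v.2.1 * m.1) + (r - v.2.2) * m.2.1 -
        (1 + b) * m.2.2) - a * (v.1 * m.1 - (σ + b) * m.2.1 + σ * m.2.2)) +
      A * (2 * m.1 * (-(σ + 1) * m.1 - v.1 * m.2.1) +
        2 * m.2.1 * (v.1 * m.1 - (σ + b) * m.2.1 + σ * m.2.2)) with hQ'
    have hQ'le : Q' ≤ -(ms + (1 - σ + 2 * e)) * (m.2.2 - a * m.2.1) ^ 2 +
        2 * (2 * ρs - v.2.2) * (m.2.2 - a * m.2.1) * m.2.1 +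
        2 * -(v.2.1 + a * v.1) * (m.2.2 - a * m.2.1) * m.1 -
        (ms - (1 - σ + 2 * e)) * A * m.2.1 ^ 2 - (ms - (1 - σ + 2 * e)) * A * m.1 ^ 2 := by
      have h1 : 0 ≤ (4 - b) / 2 * (A * m.1 ^ 2) := by
        have : 0 ≤ 4 - b := by linarith
        positivity
      have h2 : 2 * ρs = σ * A + (r - a * (1 - σ + σ * a)) := by rw [hAσ, haσ, hρ]; ring
      rw [h2, hQ', hms, ← haσ]
      have h3 : b = 4 / 3 * (σ * a) := by rw [haσ, he]; ring
      rw [h3] at h1 ⊢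
      linarith
    have hneg : κ * L + Q' < 0 := by
      have h1 : 2 * ms * A * (κ * L + Q') = L + 2 * ms * A * Q' := by
        rw [hκ]
        field_simp
      have h2 : 2 * ms * A * (κ * L + Q') < 0 := by
        rw [h1]
        have h3 := mul_le_mul_of_nonneg_left hQ'le (by positivity : 0 ≤ 2 * ms * A)
        have h4 : 0 < 4 * ρs * (ρs - ρ) := by
          have := sub_pos.2 hρlt
          positivity
        linarith
      exact neg_of_mul_neg_right h2 (by positivity)
    have hms1 : minorStep σ b r 0 v m = m := by simp [minorStep]
    simp only [zero_smul, add_zero, hms1, hm1, mul_one]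
    rw [← mul_add]
    exact mul_neg_of_pos_of_neg (Real.exp_pos _) hneg
  obtain ⟨c, hc, ε₀, hε₀, hdec⟩ := exists_linear_decay_of_hasDerivAt_neg hgc hScpt hneg
  obtain ⟨D, hD⟩ := hK.exists_bound_of_continuousOn (Real.continuous_exp.comp hWc).continuousOn
  set D' := max D 1 with hD'
  have hD'0 : 0 < D' := lt_max_of_lt_right one_pos
  have hms0' : minorStep σ b r 0 = fun _ m => m := by
    funext v m
    simp [minorStep]
  refine ⟨c / D', div_pos hc hD'0, ε₀, hε₀, fun ε hε v hv m => ?_⟩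
  have hexp : Real.exp (W v) ≤ D' := by
    have := hD v hv
    simp only [Function.comp, Real.norm_eq_abs, abs_of_pos (Real.exp_pos _)] at this
    exact this.trans (le_max_left _ _)
  rcases (areaForm_nonneg hA0.le a m).eq_or_lt with h0 | h0
  · have hm0 : m = 0 := by
      have := sq_norm_le_mul_areaForm hA0 a m
      rw [← h0, mul_zero] at this
      exact norm_eq_zero.1 (pow_eq_zero_iff two_ne_zero |>.1 (le_antisymm this (sq_nonneg _)))
    subst hm0
    have := minorStep_smul σ b r ε 0 v 0
    rw [zero_smul, zero_smul] at this
    rw [this, ← h0]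
    simp
  · set l := Real.sqrt (areaForm A a m) with hl
    have hl0 : 0 < l := Real.sqrt_pos.2 h0
    have hl2 : l ^ 2 = areaForm A a m := Real.sq_sqrt h0.le
    have hm : m = l • (l⁻¹ • m) := by rw [smul_smul, mul_inv_cancel₀ hl0.ne', one_smul]
    have h1 : areaForm A a (l⁻¹ • m) = 1 := by
      rw [areaForm_smul, ← hl2]
      field_simp
    have := hdec ε hε (v, l⁻¹ • m) ⟨hv, h1⟩
    simp only [hg, hms0', h1, zero_smul, add_zero, mul_one] at this
    rw [hm, minorStep_smul, areaForm_smul, areaForm_smul, h1]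
    have h2 : c / D' * Real.exp (W v) ≤ c := by
      rw [div_mul_eq_mul_div, div_le_iff₀ hD'0]
      gcongr
    have h3 := mul_le_mul_of_nonneg_right h2 hε.1
    have h4 := mul_le_mul_of_nonneg_left this (sq_nonneg l)
    have h5 := mul_le_mul_of_nonneg_left h3 (sq_nonneg l)
    linarith

/-- The Euclidean inner product on `ℝ × ℝ × ℝ` as a bounded bilinear form. -/
noncomputable def dotForm : (ℝ × ℝ × ℝ) →L[ℝ] (ℝ × ℝ × ℝ) →L[ℝ] ℝ :=
  let π₁ := ContinuousLinearMap.fst ℝ ℝ (ℝ × ℝ)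
  let π₂ := (ContinuousLinearMap.fst ℝ ℝ ℝ).comp (ContinuousLinearMap.snd ℝ ℝ (ℝ × ℝ))
  let π₃ := (ContinuousLinearMap.snd ℝ ℝ ℝ).comp (ContinuousLinearMap.snd ℝ ℝ (ℝ × ℝ))
  (ContinuousLinearMap.mul ℝ ℝ).bilinearComp π₁ π₁ +
    (ContinuousLinearMap.mul ℝ ℝ).bilinearComp π₂ π₂ +
    (ContinuousLinearMap.mul ℝ ℝ).bilinearComp π₃ π₃

theorem dotForm_apply (p q : ℝ × ℝ × ℝ) :
    dotForm p q = p.1 * q.1 + p.2.1 * q.2.1 + p.2.2 * q.2.2 := by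
  simp [dotForm]

theorem abs_fst_le_norm (p : ℝ × ℝ × ℝ) : |p.1| ≤ ‖p‖ := norm_fst_le p

theorem abs_snd_fst_le_norm (p : ℝ × ℝ × ℝ) : |p.2.1| ≤ ‖p‖ :=
  (norm_fst_le p.2).trans (norm_snd_le p)

theorem abs_snd_snd_le_norm (p : ℝ × ℝ × ℝ) : |p.2.2| ≤ ‖p‖ :=
  (norm_snd_le p.2).trans (norm_snd_le p)

theorem norm_le_of_abs_le {p : ℝ × ℝ × ℝ} {R : ℝ} (h1 : |p.1| ≤ R) (h2 : |p.2.1| ≤ R)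
    (h3 : |p.2.2| ≤ R) : ‖p‖ ≤ R :=
  max_le h1 (max_le h2 h3)

theorem sq_norm_le_dotForm (p : ℝ × ℝ × ℝ) : ‖p‖ ^ 2 ≤ dotForm p p := by
  have h : ‖p‖ ≤ Real.sqrt (dotForm p p) := by
    rw [dotForm_apply]
    refine norm_le_of_abs_le ?_ ?_ ?_ <;> refine Real.abs_le_sqrt ?_ <;>
      linarith [mul_self_nonneg p.1, mul_self_nonneg p.2.1, mul_self_nonneg p.2.2]
  refine (pow_le_pow_left₀ (norm_nonneg p) h 2).trans_eq (Real.sq_sqrt ?_)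
  rw [dotForm_apply]
  linarith [mul_self_nonneg p.1, mul_self_nonneg p.2.1, mul_self_nonneg p.2.2]

theorem norm_minors_le (p q : ℝ × ℝ × ℝ) : ‖minors p q‖ ≤ 2 * (‖p‖ * ‖q‖) := by
  have h : ∀ {a b c d : ℝ}, |a| ≤ ‖p‖ → |b| ≤ ‖q‖ → |c| ≤ ‖p‖ → |d| ≤ ‖q‖ →
      |a * b - c * d| ≤ 2 * (‖p‖ * ‖q‖) := by
    intro a b c d ha hb hc hd
    have h1 : |a * b| ≤ ‖p‖ * ‖q‖ := by
      rw [abs_mul]; exact mul_le_mul ha hb (abs_nonneg _) (norm_nonneg _)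
    have h2 : |c * d| ≤ ‖p‖ * ‖q‖ := by
      rw [abs_mul]; exact mul_le_mul hc hd (abs_nonneg _) (norm_nonneg _)
    linarith [abs_sub (a * b) (c * d)]
  exact norm_le_of_abs_le
    (h (abs_fst_le_norm p) (abs_snd_fst_le_norm q) (abs_snd_fst_le_norm p) (abs_fst_le_norm q))
    (h (abs_fst_le_norm p) (abs_snd_snd_le_norm q) (abs_snd_snd_le_norm p) (abs_fst_le_norm q))
    (h (abs_snd_fst_le_norm p) (abs_snd_snd_le_norm q) (abs_snd_snd_le_norm p)
      (abs_snd_fst_le_norm q))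

theorem areaForm_le {A : ℝ} (hA : 0 ≤ A) (c : ℝ) (m : ℝ × ℝ × ℝ) :
    areaForm A c m ≤ (2 + 2 * c ^ 2 + 2 * A) * ‖m‖ ^ 2 := by
  have h1 : m.1 ^ 2 ≤ ‖m‖ ^ 2 := sq_le_sq.2 ((abs_fst_le_norm m).trans (le_abs_self _))
  have h2 : m.2.1 ^ 2 ≤ ‖m‖ ^ 2 := sq_le_sq.2 ((abs_snd_fst_le_norm m).trans (le_abs_self _))
  have h3 : m.2.2 ^ 2 ≤ ‖m‖ ^ 2 := sq_le_sq.2 ((abs_snd_snd_le_norm m).trans (le_abs_self _))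
  have h4 := mul_le_mul_of_nonneg_left h1 hA
  have h5 := mul_le_mul_of_nonneg_left h2 hA
  have h6 := mul_le_mul_of_nonneg_left h2 (sq_nonneg c)
  unfold areaForm
  nlinarith [sq_nonneg (m.2.2 + c * m.2.1)]

theorem curl_lorenzField_sq_le {σ b r R : ℝ} (hσ : 0 < σ) (hr : 0 < r) {v : ℝ × ℝ × ℝ}
    (hv : ‖v‖ ≤ R) (p q : ℝ × ℝ × ℝ) :
    (dotForm (fderiv ℝ (lorenzField σ b r) v p) q -
      dotForm (fderiv ℝ (lorenzField σ b r) v q) p) ^ 2 ≤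
      (r + σ + 4 * R) ^ 2 * ‖minors p q‖ ^ 2 := by
  have hid : dotForm (fderiv ℝ (lorenzField σ b r) v p) q -
      dotForm (fderiv ℝ (lorenzField σ b r) v q) p =
      (r - v.2.2 - σ) * (minors p q).1 + v.2.1 * (minors p q).2.1 +
        2 * v.1 * (minors p q).2.2 := by
    rw [dotForm_apply, dotForm_apply, fderiv_lorenzField_apply, fderiv_lorenzField_apply]
    simp only [minors]
    ring
  rw [hid, ← mul_pow]
  have hR : 0 ≤ R := (norm_nonneg v).trans hv
  set m := minors p q
  have a1 := (abs_fst_le_norm v).trans hv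
  have a2 := (abs_snd_fst_le_norm v).trans hv
  have a3 := (abs_snd_snd_le_norm v).trans hv
  have b1 : |r - v.2.2 - σ| ≤ r + σ + R := by
    rw [abs_le] at a3 ⊢
    constructor <;> linarith [a3.1, a3.2]
  have c1 : |(r - v.2.2 - σ) * m.1| ≤ (r + σ + R) * ‖m‖ := by
    rw [abs_mul]; exact mul_le_mul b1 (abs_fst_le_norm m) (abs_nonneg _) (by positivity)
  have c2 : |v.2.1 * m.2.1| ≤ R * ‖m‖ := by
    rw [abs_mul]; exact mul_le_mul a2 (abs_snd_fst_le_norm m) (abs_nonneg _) (by positivity)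
  have c3 : |v.1 * m.2.2| ≤ R * ‖m‖ := by
    rw [abs_mul]; exact mul_le_mul a1 (abs_snd_snd_le_norm m) (abs_nonneg _) (by positivity)
  refine sq_le_sq' ?_ ?_
  · linarith [(abs_le.1 c1).1, (abs_le.1 c2).1, (abs_le.1 c3).1]
  · linarith [(abs_le.1 c1).2, (abs_le.1 c2).2, (abs_le.1 c3).2]

/-- The quadratic function showing that the Lorenz system is dissipative. -/
def lorenzEnergy (σ r : ℝ) (p : ℝ × ℝ × ℝ) : ℝ :=
  r * p.1 ^ 2 + σ * p.2.1 ^ 2 + σ * (p.2.2 - 2 * r) ^ 2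

theorem continuous_lorenzEnergy (σ r : ℝ) : Continuous (lorenzEnergy σ r) := by
  unfold lorenzEnergy
  fun_prop

theorem isCompact_lorenzEnergy_le {σ r : ℝ} (hσ : 0 < σ) (hr : 0 < r) (M : ℝ) :
    IsCompact {p | lorenzEnergy σ r p ≤ M} := by
  refine Metric.isCompact_of_isClosed_isBounded
    (isClosed_le (continuous_lorenzEnergy σ r) continuous_const) ?_
  refine (Metric.isBounded_closedBall (x := 0) (r := 2 * r + 1 + M / r + M / σ)).subset
    fun p hp => ?_
  have hp' : lorenzEnergy σ r p ≤ M := hp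
  rw [mem_closedBall_zero_iff]
  unfold lorenzEnergy at hp'
  have h1 : 0 ≤ r * p.1 ^ 2 := by positivity
  have h2 : 0 ≤ σ * p.2.1 ^ 2 := by positivity
  have h3 : 0 ≤ σ * (p.2.2 - 2 * r) ^ 2 := by positivity
  have hM : 0 ≤ M := by linarith
  have hMr : 0 ≤ M / r := by positivity
  have hMσ : 0 ≤ M / σ := by positivity
  have e1 : p.1 ^ 2 ≤ M / r := by rw [le_div_iff₀ hr]; linarith
  have e2 : p.2.1 ^ 2 ≤ M / σ := by rw [le_div_iff₀ hσ]; linarith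
  have e3 : (p.2.2 - 2 * r) ^ 2 ≤ M / σ := by rw [le_div_iff₀ hσ]; linarith
  refine norm_le_of_abs_le ?_ ?_ ?_ <;> rw [abs_le] <;> constructor <;> nlinarith

theorem exists_lorenzEnergy_dissipation {σ b r : ℝ} (hσ : 0 < σ) (hb : 0 < b) (hr : 0 < r) :
    ∃ k > 0, ∃ C, ∀ p : ℝ × ℝ × ℝ,
      -2 * σ * (r * p.1 ^ 2 + p.2.1 ^ 2 + b * (p.2.2 - r) ^ 2 - b * r ^ 2) ≤
        -k * lorenzEnergy σ r p + C := by
  set k := min (2 * σ) (min 2 b) with hk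
  have k0 : 0 < k := by positivity
  have k1 : k ≤ 2 * σ := min_le_left _ _
  have k2 : k ≤ 2 := (min_le_right _ _).trans (min_le_left _ _)
  have k3 : k ≤ b := (min_le_right _ _).trans (min_le_right _ _)
  refine ⟨k, k0, 4 * σ * b * r ^ 2, fun p => ?_⟩
  unfold lorenzEnergy
  have h1 := mul_le_mul_of_nonneg_right k1 (by positivity : 0 ≤ r * p.1 ^ 2)
  have h2 := mul_le_mul_of_nonneg_right k2 (by positivity : 0 ≤ σ * p.2.1 ^ 2)
  have h3 := mul_le_mul_of_nonneg_right k3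
    (by positivity : 0 ≤ 2 * σ * ((p.2.2 - r) ^ 2 + r ^ 2))
  have h4 : 0 ≤ k * σ * p.2.2 ^ 2 := by positivity
  linarith

theorem lorenzEnergy_eulerStep (σ b r ε : ℝ) (p : ℝ × ℝ × ℝ) :
    lorenzEnergy σ r (p + ε • lorenzField σ b r p) = lorenzEnergy σ r p +
      ε * (-2 * σ * (r * p.1 ^ 2 + p.2.1 ^ 2 + b * (p.2.2 - r) ^ 2 - b * r ^ 2)) +
      ε ^ 2 * (r * (lorenzField σ b r p).1 ^ 2 + σ * (lorenzField σ b r p).2.1 ^ 2 +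
        σ * (lorenzField σ b r p).2.2 ^ 2) := by
  simp only [lorenzEnergy, lorenzField, Prod.fst_add, Prod.snd_add, Prod.smul_fst, Prod.smul_snd,
    smul_eq_mul]
  ring

/-- Large sublevel sets of the energy are invariant under the Euler map with small step size. -/
theorem exists_lorenzEnergy_invariant {σ b r : ℝ} (hσ : 0 < σ) (hb : 0 < b) (hr : 0 < r) :
    ∃ M₀, ∀ M, M₀ ≤ M → ∃ ε₀ > (0:ℝ), ∀ ε ∈ Set.Ioc (0:ℝ) ε₀, ∀ p, lorenzEnergy σ r p ≤ M →
      lorenzEnergy σ r (p + ε • lorenzField σ b r p) ≤ M := by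
  obtain ⟨k, hk, C, hC⟩ := exists_lorenzEnergy_dissipation hσ hb hr
  refine ⟨C / k + 1, fun M hM => ?_⟩
  have hcont : Continuous fun p : ℝ × ℝ × ℝ => r * (lorenzField σ b r p).1 ^ 2 +
      σ * (lorenzField σ b r p).2.1 ^ 2 + σ * (lorenzField σ b r p).2.2 ^ 2 := by
    unfold lorenzField
    fun_prop
  obtain ⟨N, hN⟩ := (isCompact_lorenzEnergy_le hσ hr M).exists_bound_of_continuousOn
    hcont.continuousOn
  refine ⟨min (1 / k) (k / (|N| + 1)), by positivity, fun ε hε p hp => ?_⟩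
  have e1 : ε * k ≤ 1 := by
    rw [← le_div_iff₀ hk]; exact hε.2.trans (min_le_left _ _)
  have e2 : ε * (|N| + 1) ≤ k := by
    rw [← le_div_iff₀ (by positivity)]; exact hε.2.trans (min_le_right _ _)
  have hM' : C + k ≤ k * M := by
    have := mul_le_mul_of_nonneg_left hM hk.le
    have h2 : k * (C / k + 1) = C + k := by field_simp
    linarith
  rw [lorenzEnergy_eulerStep]
  have h1 := mul_le_mul_of_nonneg_left (hC p) hε.1.le
  have h2 := mul_le_mul_of_nonneg_left ((le_abs_self _).trans ((hN p hp).trans (le_abs_self N)))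
    (sq_nonneg ε)
  have h3 := mul_le_mul_of_nonneg_left hp (sub_nonneg.2 e1)
  have h4 := mul_le_mul_of_nonneg_left hM' hε.1.le
  have h5 := mul_le_mul_of_nonneg_left e2 hε.1.le
  nlinarith [sq_nonneg ε]

theorem hasDerivAt_coords {u : ℝ → ℝ × ℝ × ℝ} {w : ℝ × ℝ × ℝ} {t : ℝ} (h : HasDerivAt u w t) :
    HasDerivAt (fun t => (u t).1) w.1 t ∧ HasDerivAt (fun t => (u t).2.1) w.2.1 t ∧
      HasDerivAt (fun t => (u t).2.2) w.2.2 t :=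
  ⟨(ContinuousLinearMap.fst ℝ ℝ (ℝ × ℝ)).hasFDerivAt.comp_hasDerivAt t h,
    ((ContinuousLinearMap.fst ℝ ℝ ℝ).comp
      (ContinuousLinearMap.snd ℝ ℝ (ℝ × ℝ))).hasFDerivAt.comp_hasDerivAt t h,
    ((ContinuousLinearMap.snd ℝ ℝ ℝ).comp
      (ContinuousLinearMap.snd ℝ ℝ (ℝ × ℝ))).hasFDerivAt.comp_hasDerivAt t h⟩

theorem lorenz_bounded {σ b r : ℝ} (hσ : 0 < σ) (hb : 0 < b) (hr : 0 < r) {u : ℝ → ℝ × ℝ × ℝ}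
    (hu : ∀ t, 0 ≤ t → HasDerivAt u (lorenzField σ b r (u t)) t) :
    ∃ M, ∀ t, 0 ≤ t → lorenzEnergy σ r (u t) ≤ M := by
  obtain ⟨k, hk, C, hC⟩ := exists_lorenzEnergy_dissipation hσ hb hr
  have hV : ∀ t, 0 ≤ t → HasDerivAt (fun t => lorenzEnergy σ r (u t))
      (-2 * σ * (r * (u t).1 ^ 2 + (u t).2.1 ^ 2 + b * ((u t).2.2 - r) ^ 2 - b * r ^ 2)) t := by
    intro t ht
    obtain ⟨h1, h2, h3⟩ := hasDerivAt_coords (hu t ht)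
    have h := (((h1.pow 2).const_mul r).add ((h2.pow 2).const_mul σ)).add
      (((h3.sub_const (2 * r)).pow 2).const_mul σ)
    refine h.congr_deriv ?_
    simp [lorenzField]
    ring
  have hanti : AntitoneOn (fun t => (lorenzEnergy σ r (u t) - C / k) * Real.exp (k * t))
      (Set.Ici 0) := by
    have hd : ∀ t, 0 ≤ t → HasDerivAt
        (fun t => (lorenzEnergy σ r (u t) - C / k) * Real.exp (k * t)) _ t := fun t ht =>
      ((hV t ht).sub_const (C / k)).mul ((hasDerivAt_id t).const_mul k).exp
    refine antitoneOn_of_hasDerivWithinAt_nonpos (convex_Ici 0)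
      (fun t ht => (hd t ht).continuousAt.continuousWithinAt)
      (fun t ht => (hd t (interior_subset ht)).hasDerivWithinAt) (fun t ht => ?_)
    have h1 := hC (u t)
    have h2 : k * (C / k) = C := by field_simp
    have h3 := Real.exp_pos (k * t)
    simp only [id, mul_one]
    have h4 : -2 * σ * (r * (u t).1 ^ 2 + (u t).2.1 ^ 2 + b * ((u t).2.2 - r) ^ 2 - b * r ^ 2)
      + (lorenzEnergy σ r (u t) - C / k) * k ≤ 0 := by linarith
    nlinarith
  refine ⟨C / k + |lorenzEnergy σ r (u 0) - C / k|, fun t ht => ?_⟩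
  have h1 := hanti Set.self_mem_Ici ht ht
  simp only [mul_zero, Real.exp_zero, mul_one] at h1
  have h2 : 1 ≤ Real.exp (k * t) := Real.one_le_exp (by positivity)
  by_contra hcon
  push Not at hcon
  have h3 := le_abs_self (lorenzEnergy σ r (u 0) - C / k)
  have h4 := abs_nonneg (lorenzEnergy σ r (u 0) - C / k)
  nlinarith

/-- Contraction of phase space onto the curve `(ξ, ξ, ξ² / b)`. -/
noncomputable def lorenzHomotopy (b : ℝ) (q : ℝ × ℝ × ℝ × ℝ) : ℝ × ℝ × ℝ :=
  (q.2.1, q.2.2.1 + q.1 * (q.2.1 - q.2.2.1), q.2.2.2 + q.1 * (q.2.1 ^ 2 / b - q.2.2.2))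

theorem contDiff_lorenzHomotopy (b : ℝ) {k : WithTop ℕ∞} : ContDiff ℝ k (lorenzHomotopy b) := by
  unfold lorenzHomotopy
  fun_prop

theorem fderiv_lorenzHomotopy_apply (b s : ℝ) (v : ℝ × ℝ × ℝ) :
    fderiv ℝ (lorenzHomotopy b) (s, v) (1, 0) = (0, v.1 - v.2.1, v.1 ^ 2 / b - v.2.2) := by
  have h1 := (((contDiff_lorenzHomotopy b (k := 1)).differentiable (by norm_num))
    (s, v)).hasFDerivAt.comp_hasDerivAt s ((hasDerivAt_id s).prodMk (hasDerivAt_const s v))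
  have h2 : HasDerivAt (fun s => lorenzHomotopy b (s, v))
      (0, v.1 - v.2.1, v.1 ^ 2 / b - v.2.2) s := by
    have h3 := ((hasDerivAt_id s).mul_const (v.1 - v.2.1)).const_add v.2.1
    have h4 := ((hasDerivAt_id s).mul_const (v.1 ^ 2 / b - v.2.2)).const_add v.2.2
    rw [one_mul] at h3 h4
    exact (hasDerivAt_const s v.1).prodMk (h3.prodMk h4)
  exact h1.unique h2

theorem norm_lorenzHomotopy_velocity_le {σ b R : ℝ} (r : ℝ) (hσ : 0 < σ) (hb : 0 < b)
    {v : ℝ × ℝ × ℝ} (hv : ‖v‖ ≤ R) :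
    ‖((0, v.1 - v.2.1, v.1 ^ 2 / b - v.2.2) : ℝ × ℝ × ℝ)‖ ≤
      (1 / σ + (1 + R / σ) / b) * ‖lorenzField σ b r v‖ := by
  have hR : 0 ≤ R := (norm_nonneg v).trans hv
  set f := lorenzField σ b r v with hf
  have f1 : v.1 - v.2.1 = -(f.1 / σ) := by
    simp only [hf, lorenzField]
    field_simp
  have f3 : v.1 ^ 2 / b - v.2.2 = (f.2.2 + v.1 * (v.1 - v.2.1)) / b := by
    simp only [hf, lorenzField]
    field_simp
    ring
  have e1 : |v.1 - v.2.1| ≤ 1 / σ * ‖f‖ := by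
    rw [f1, abs_neg, abs_div, abs_of_pos hσ, div_eq_inv_mul, one_div]
    exact mul_le_mul_of_nonneg_left (abs_fst_le_norm f) (by positivity)
  have e2 : |v.1 ^ 2 / b - v.2.2| ≤ (1 + R / σ) / b * ‖f‖ := by
    rw [f3, abs_div, abs_of_pos hb, div_mul_eq_mul_div]
    refine div_le_div_of_nonneg_right ((abs_add_le _ _).trans ?_) hb.le
    have h1 : |v.1 * (v.1 - v.2.1)| ≤ R * (1 / σ * ‖f‖) := by
      rw [abs_mul]
      exact mul_le_mul ((abs_fst_le_norm v).trans hv) e1 (abs_nonneg _) hR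
    have h2 := abs_snd_snd_le_norm f
    calc _ ≤ ‖f‖ + R * (1 / σ * ‖f‖) := add_le_add h2 h1
      _ = _ := by ring
  have p1 : 0 ≤ 1 / σ * ‖f‖ := by positivity
  have p2 : 0 ≤ (1 + R / σ) / b * ‖f‖ := by positivity
  rw [add_mul]
  refine norm_le_of_abs_le ?_ ?_ ?_
  · simpa using add_nonneg p1 p2
  · exact e1.trans (by linarith)
  · exact e2.trans (by linarith)

theorem exists_bound_integral_sq_lorenzField_of_area_contraction {σ b r : ℝ} (hσ : 0 < σ)
    (hb : 0 < b) (hb4 : b ≤ 4) (hr0 : 0 < r) (h : b < 2 * σ) (hr : r < (σ + b) * (b + 1) / σ)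
    {u : ℝ → ℝ × ℝ × ℝ} (hu : ∀ t, 0 ≤ t → HasDerivAt u (lorenzField σ b r (u t)) t) :
    ∃ M, ∀ T, 1 ≤ T → ∫ τ in (1 : ℝ)..T, ‖lorenzField σ b r (u τ)‖ ^ 2 ≤ M := by
  obtain ⟨M₀, hM₀⟩ := lorenz_bounded hσ hb hr0 hu
  obtain ⟨M₁, hM₁⟩ := exists_lorenzEnergy_invariant (b := b) hσ hb hr0
  set K₀ := {p | lorenzEnergy σ r p ≤ M₀} with hK₀
  have hcpt : IsCompact (Set.Icc (0 : ℝ) 1 ×ˢ K₀) :=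
    isCompact_Icc.prod (isCompact_lorenzEnergy_le hσ hr0 M₀)
  obtain ⟨M₂, hM₂⟩ := hcpt.exists_bound_of_continuousOn
    ((continuous_lorenzEnergy σ r).comp
      (contDiff_lorenzHomotopy b (k := 1)).continuous).continuousOn
  set M := max M₀ (max M₁ M₂) with hM
  have hMM₀ : M₀ ≤ M := le_max_left _ _
  have hMM₁ : M₁ ≤ M := (le_max_left _ _).trans (le_max_right _ _)
  have hMM₂ : M₂ ≤ M := (le_max_right _ _).trans (le_max_right _ _)
  set K := {p | lorenzEnergy σ r p ≤ M} with hK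
  have hKc : IsCompact K := isCompact_lorenzEnergy_le hσ hr0 M
  obtain ⟨ε₁, hε₁, hinv⟩ := hM₁ M hMM₁
  obtain ⟨W, A, a, hW, hA, c, hc, ε₂, hε₂, har⟩ :=
    lorenz_area_contraction hσ hb hb4 h hr hKc
  obtain ⟨R, hR⟩ := hKc.exists_bound_of_continuousOn continuous_id.continuousOn
  obtain ⟨w, hw⟩ := hKc.exists_bound_of_continuousOn hW.continuousOn
  have hexp1 : ∀ v ∈ K, Real.exp (W v) ≤ Real.exp w := fun v hv =>
    Real.exp_le_exp.2 ((le_abs_self _).trans (hw v hv))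
  have hexp2 : ∀ v ∈ K, 1 ≤ Real.exp w * Real.exp (W v) := fun v hv => by
    rw [← Real.exp_add]
    exact Real.one_le_exp (by linarith [(abs_le.1 (hw v hv)).1])
  refine exists_bound_integral_sq_velocity (contDiff_lorenzField σ b r) dotForm sq_norm_le_dotForm
    (K := K) (K₀ := K₀) (ε₀ := min ε₁ ε₂)
    (ar := fun v p q => Real.exp (W v) * areaForm A a (minors p q)) (c := c)
    (C₀ := (r + σ + 4 * R) ^ 2 * ((2 + (1 + 2 * a ^ 2) / A) * Real.exp w))
    (C₁ := Real.exp w * ((2 + 2 * a ^ 2 + 2 * A) * 4)) (C₂ := 1 / σ + (1 + R / σ) / b)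
    (h := lorenzHomotopy b) (γ := fun ξ => (ξ, ξ, ξ ^ 2 / b)) (ξ := fun v => v.1)
    hKc.isBounded (fun p hp => le_trans hp hMM₀) (lt_min hε₁ hε₂)
    (fun ε hε v hv => hinv ε ⟨hε.1, hε.2.trans (min_le_left _ _)⟩ v hv) hc
    (by positivity) (by positivity) ?_ ?_ ?_ (contDiff_lorenzHomotopy b) ?_ (by fun_prop)
    (by fun_prop) ?_ ?_ ?_ (fun t ht => hu t ht.le) (fun t ht => hM₀ t ht.le)
  · intro ε hε v hv p q
    simp only [minors_add_smul_fderiv_lorenzField]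
    exact har ε ⟨hε.1.le, hε.2.trans (min_le_right _ _)⟩ v hv _
  · intro v hv p q
    refine (curl_lorenzField_sq_le hσ hr0 (hR v hv) p q).trans ?_
    rw [mul_assoc]
    refine mul_le_mul_of_nonneg_left ?_ (sq_nonneg _)
    have h1 := sq_norm_le_mul_areaForm hA a (minors p q)
    have h2 := mul_le_mul_of_nonneg_right (hexp2 v hv)
      (le_trans (sq_nonneg _) h1)
    linarith
  · intro v hv p q
    have h1 := areaForm_le hA.le a (minors p q)
    have h2 := pow_le_pow_left₀ (norm_nonneg _) (norm_minors_le p q) 2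
    have h3 := mul_le_mul_of_nonneg_left h2 (by positivity : 0 ≤ 2 + 2 * a ^ 2 + 2 * A)
    have h4 := mul_le_mul (hexp1 v hv) (h1.trans h3) (areaForm_nonneg hA.le a _)
      (Real.exp_pos w).le
    refine h4.trans_eq ?_
    ring
  · intro v
    simp [lorenzHomotopy]
  · intro v
    simp [lorenzHomotopy]
  · intro s hs v hv
    exact ((le_abs_self _).trans (hM₂ (s, v) ⟨hs, hv⟩)).trans hMM₂
  · intro s hs v hv
    rw [fderiv_lorenzHomotopy_apply]
    exact norm_lorenzHomotopy_velocity_le r hσ hb (hR v (le_trans hv hMM₀))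

/-- A Lyapunov function for the Lorenz system in the parameter range `2 * σ ≤ b`. -/
noncomputable def lorenzLyapunov (σ b r N e : ℝ) (p : ℝ × ℝ × ℝ) : ℝ :=
  let f := lorenzField σ b r p
  let q := f.2.2 - p.1 * f.1 / σ
  f.1 ^ 2 / 2 - σ * (r - 1) * p.1 ^ 2 / 2 + p.1 ^ 4 / 8 +
    σ * p.1 ^ 2 * (p.2.2 - p.1 ^ 2 / (2 * σ)) / 2 + σ / (2 * b) * p.1 ^ 2 * q +
    σ * (b / (2 * σ) - 1) / (4 * b) * p.1 ^ 4 + N * q ^ 2 - e * (f.1 * f.2.1)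

/-- The derivative of `lorenzLyapunov` along the Lorenz system. -/
noncomputable def lorenzLyapunovRate (σ b r N e : ℝ) (p : ℝ × ℝ × ℝ) : ℝ :=
  let f := lorenzField σ b r p
  let q := f.2.2 - p.1 * f.1 / σ
  f.1 * ((σ / b - 4 * N * (b / (2 * σ) - 1)) * p.1 * q - (σ + 1) * f.1) - 2 * N * b * q ^ 2 -
    e * (σ * f.2.1 ^ 2 - σ * f.1 * f.2.1 +
      f.1 * (r * f.1 - f.2.1 - p.2.2 * f.1 - p.1 * f.2.2))

theorem hasDerivAt_lorenzLyapunov {σ b : ℝ} (hσ : 0 < σ) (hb : 0 < b) (r N e : ℝ)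
    {u : ℝ → ℝ × ℝ × ℝ} {t : ℝ} (hu : HasDerivAt u (lorenzField σ b r (u t)) t) :
    HasDerivAt (fun t => lorenzLyapunov σ b r N e (u t))
      (lorenzLyapunovRate σ b r N e (u t)) t := by
  obtain ⟨hx, hy, hz⟩ := hasDerivAt_coords hu
  have h1 := (hx.sub hy).const_mul (-σ)
  have h2 := ((hx.const_mul r).sub hy).sub (hx.mul hz)
  have h3 := (hz.const_mul (-b)).add (hx.mul hy)
  have hq := h3.sub ((hx.mul h1).div_const σ)
  have hw := hz.sub ((hx.pow 2).div_const (2 * σ))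
  have h := (((((((h1.pow 2).div_const 2).sub
    (((hx.pow 2).const_mul (σ * (r - 1))).div_const 2)).add
    ((hx.pow 4).div_const 8)).add
    ((((hx.pow 2).const_mul σ).mul hw).div_const 2)).add
    (((hx.pow 2).const_mul (σ / (2 * b))).mul hq)).add
    ((hx.pow 4).const_mul (σ * (b / (2 * σ) - 1) / (4 * b)))).add
    ((hq.pow 2).const_mul N)
  have h := h.sub ((h1.mul h2).const_mul e)
  refine h.congr_deriv ?_
  simp [lorenzLyapunovRate, lorenzField]
  field_simp
  ring

theorem exists_negative_definite_bound {σ b : ℝ} (hσ : 0 < σ) (hb : 0 < b) (h : 2 * σ ≤ b)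
    (R : ℝ) : ∃ N, ∃ c > 0, ∀ x p q : ℝ, |x| ≤ R →
      -(σ + 1) * p ^ 2 + (σ / b - 4 * N * (b / (2 * σ) - 1)) * x * p * q - 2 * N * b * q ^ 2 ≤
        -c * (p ^ 2 + q ^ 2) := by
  rcases h.eq_or_lt with h | h
  · have hk : b / (2 * σ) - 1 = 0 := by rw [h, div_self hb.ne', sub_self]
    set S := σ / b * R with hS
    refine ⟨(S ^ 2 / 2 + 1 / 2) / (2 * b), 1 / 2, by norm_num, fun x p q hx => ?_⟩
    have h2 : 2 * ((S ^ 2 / 2 + 1 / 2) / (2 * b)) * b = S ^ 2 / 2 + 1 / 2 := by field_simp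
    rw [hk, mul_zero, sub_zero, h2]
    have h3 : (σ / b * x * q) ^ 2 ≤ S ^ 2 * q ^ 2 := by
      rw [mul_pow]
      refine mul_le_mul_of_nonneg_right (sq_le_sq' ?_ ?_) (sq_nonneg q)
      · have := mul_le_mul_of_nonneg_left (abs_le.1 hx).1 (by positivity : 0 ≤ σ / b)
        linarith
      · exact mul_le_mul_of_nonneg_left (abs_le.1 hx).2 (by positivity)
    nlinarith [sq_nonneg (p - σ / b * x * q), mul_nonneg hσ.le (sq_nonneg p)]
  · have hk : 0 < b / (2 * σ) - 1 := by
      rw [sub_pos, one_lt_div (by positivity)]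
      exact h
    set k := b / (2 * σ) - 1
    refine ⟨σ / (4 * k * b), min 1 (σ / (2 * k)), by positivity, fun x p q _ => ?_⟩
    have h1 : σ / b - 4 * (σ / (4 * k * b)) * k = 0 := by field_simp; ring
    have h2 : 2 * (σ / (4 * k * b)) * b = σ / (2 * k) := by field_simp; ring
    rw [h1, h2]
    have h3 := mul_le_mul_of_nonneg_right (min_le_left 1 (σ / (2 * k))) (sq_nonneg p)
    have h4 := mul_le_mul_of_nonneg_right (min_le_right 1 (σ / (2 * k))) (sq_nonneg q)
    nlinarith [mul_nonneg hσ.le (sq_nonneg p)]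

theorem exists_lorenzLyapunovRate_le {σ b r : ℝ} (hσ : 0 < σ) (hb : 0 < b) (hr : 0 < r)
    (h : 2 * σ ≤ b) (R : ℝ) :
    ∃ N e, ∃ k > 0, ∀ p : ℝ × ℝ × ℝ, ‖p‖ ≤ R →
      lorenzLyapunovRate σ b r N e p ≤ -k * ‖lorenzField σ b r p‖ ^ 2 := by
  obtain ⟨N, c, hc, hN⟩ := exists_negative_definite_bound hσ hb h R
  set C := (σ + 1) ^ 2 / (2 * σ) + r + |R| + 1 / 2 + R ^ 2 + R ^ 2 / σ with hC
  have hC0 : 0 < C := by positivity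
  set e := c / (2 * C) with he
  have he0 : 0 < e := by positivity
  have heC : e * C = c / 2 := by rw [he]; field_simp
  set k := min (c / 2 / (2 + 2 * (R ^ 2 / σ ^ 2))) (e * σ / 2) with hk
  have hk0 : 0 < k := by positivity
  have hk1 : k * (2 + 2 * (R ^ 2 / σ ^ 2)) ≤ c / 2 := by
    rw [← le_div_iff₀ (by positivity)]
    exact min_le_left _ _
  have hk2 : k ≤ e * σ / 2 := min_le_right _ _
  refine ⟨N, e, k, hk0, fun p hp => ?_⟩
  have hR : 0 ≤ R := (norm_nonneg p).trans hp
  have hf := sq_norm_le_dotForm (lorenzField σ b r p)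
  rw [dotForm_apply] at hf
  have hN' := hN p.1 (lorenzField σ b r p).1
    ((lorenzField σ b r p).2.2 - p.1 * (lorenzField σ b r p).1 / σ)
    ((abs_fst_le_norm p).trans hp)
  unfold lorenzLyapunovRate
  have hx := (abs_fst_le_norm p).trans hp
  have hz := (abs_snd_snd_le_norm p).trans hp
  generalize lorenzField σ b r p = f at *
  obtain ⟨f1, f2, f3⟩ := f
  simp only at *
  generalize p.1 = x at *
  generalize p.2.2 = z at *
  obtain ⟨q, hq⟩ : ∃ q, q = f3 - x * f1 / σ := ⟨_, rfl⟩
  rw [← hq] at hN' ⊢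
  have hf3 : f3 = q + x / σ * f1 := by rw [hq]; ring
  have hx2 : x ^ 2 ≤ R ^ 2 := sq_le_sq' (abs_le.1 hx).1 (abs_le.1 hx).2
  have hxσ : (x / σ) ^ 2 ≤ R ^ 2 / σ ^ 2 := by
    rw [div_pow]
    exact div_le_div_of_nonneg_right hx2 (by positivity)
  have e1 : (σ + 1) * (f1 * f2) ≤ σ / 2 * f2 ^ 2 + (σ + 1) ^ 2 / (2 * σ) * f1 ^ 2 := by
    have : σ / 2 * f2 ^ 2 + (σ + 1) ^ 2 / (2 * σ) * f1 ^ 2 - (σ + 1) * (f1 * f2) =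
      (σ * f2 - (σ + 1) * f1) ^ 2 / (2 * σ) := by field_simp; ring
    have : 0 ≤ (σ * f2 - (σ + 1) * f1) ^ 2 / (2 * σ) := by positivity
    linarith
  have e2 : z * f1 ^ 2 ≤ |R| * f1 ^ 2 :=
    mul_le_mul_of_nonneg_right (((le_abs_self z).trans hz).trans (le_abs_self R)) (sq_nonneg _)
  have e3 : x * f1 * q ≤ R ^ 2 * f1 ^ 2 + 1 / 2 * q ^ 2 := by
    nlinarith [sq_nonneg (x * f1 - q), mul_le_mul_of_nonneg_right hx2 (sq_nonneg f1),
      mul_nonneg (sq_nonneg x) (sq_nonneg f1)]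
  have e4 : x ^ 2 / σ * f1 ^ 2 ≤ R ^ 2 / σ * f1 ^ 2 :=
    mul_le_mul_of_nonneg_right (div_le_div_of_nonneg_right hx2 hσ.le) (sq_nonneg _)
  have e5 : -(σ * f2 ^ 2 - σ * f1 * f2 + f1 * (r * f1 - f2 - z * f1 - x * f3)) ≤
      -(σ / 2) * f2 ^ 2 + C * (f1 ^ 2 + q ^ 2) := by
    have h1 : f1 * (x * f3) = x * f1 * q + x ^ 2 / σ * f1 ^ 2 := by rw [hf3]; ring
    have h2 : 1 / 2 * q ^ 2 ≤ C * q ^ 2 := by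
      refine mul_le_mul_of_nonneg_right ?_ (sq_nonneg q)
      have : 0 ≤ (σ + 1) ^ 2 / (2 * σ) + r + |R| + R ^ 2 + R ^ 2 / σ := by positivity
      linarith
    have h3 : C * f1 ^ 2 = (σ + 1) ^ 2 / (2 * σ) * f1 ^ 2 + r * f1 ^ 2 + |R| * f1 ^ 2 +
      1 / 2 * f1 ^ 2 + R ^ 2 * f1 ^ 2 + R ^ 2 / σ * f1 ^ 2 := by rw [hC]; ring
    linarith only [sq_nonneg f1, mul_nonneg hr.le (sq_nonneg f1), e1, e2, e3, e4, h1, h2, h3]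
  have e6 := mul_le_mul_of_nonneg_left e5 he0.le
  have e7 : f3 ^ 2 ≤ 2 * q ^ 2 + 2 * (R ^ 2 / σ ^ 2) * f1 ^ 2 := by
    have h1 := mul_le_mul_of_nonneg_right hxσ (sq_nonneg f1)
    have h2 := add_sq_le (a := q) (b := x / σ * f1)
    rw [← hf3, mul_pow (x / σ)] at h2
    clear_value k e C
    linarith only [h1, h2]
  have e8 : k * f2 ^ 2 ≤ e * σ / 2 * f2 ^ 2 := mul_le_mul_of_nonneg_right hk2 (sq_nonneg _)
  have e9 : ‖(f1, f2, f3)‖ ^ 2 ≤ (2 + 2 * (R ^ 2 / σ ^ 2)) * (f1 ^ 2 + q ^ 2) + f2 ^ 2 := by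
    have : 0 ≤ R ^ 2 / σ ^ 2 * q ^ 2 := by positivity
    linarith only [sq_nonneg f1, this, hf, e7]
  have e10 := mul_le_mul_of_nonneg_left e9 hk0.le
  have e11 := mul_le_mul_of_nonneg_right hk1 (by positivity : 0 ≤ f1 ^ 2 + q ^ 2)
  have e12 : e * (C * (f1 ^ 2 + q ^ 2)) = c / 2 * (f1 ^ 2 + q ^ 2) := by rw [← mul_assoc, heC]
  linarith only [hN', e6, e8, e10, e11, e12]

theorem exists_bound_integral_sq_lorenzField_of_lyapunov {σ b r : ℝ} (hσ : 0 < σ)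
    (hb : 0 < b) (hr : 0 < r) (h : 2 * σ ≤ b)
    {u : ℝ → ℝ × ℝ × ℝ} (hu : ∀ t, 0 ≤ t → HasDerivAt u (lorenzField σ b r (u t)) t) :
    ∃ M, ∀ T, 1 ≤ T → ∫ τ in (1 : ℝ)..T, ‖lorenzField σ b r (u τ)‖ ^ 2 ≤ M := by
  obtain ⟨M₀, hM₀⟩ := lorenz_bounded hσ hb hr hu
  have hK := isCompact_lorenzEnergy_le hσ hr M₀
  obtain ⟨R, hR⟩ := hK.exists_bound_of_continuousOn continuous_id.continuousOn
  obtain ⟨N, e, k, hk, hrate⟩ := exists_lorenzLyapunovRate_le hσ hb hr h R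
  have hLc : Continuous (lorenzLyapunov σ b r N e) := by
    unfold lorenzLyapunov lorenzField
    fun_prop
  have hDc : Continuous (lorenzLyapunovRate σ b r N e) := by
    unfold lorenzLyapunovRate lorenzField
    fun_prop
  obtain ⟨L, hL⟩ := hK.exists_bound_of_continuousOn hLc.continuousOn
  refine ⟨2 * L / k, fun T hT => ?_⟩
  have hpos : ∀ t ∈ Set.uIcc 1 T, 0 ≤ t := fun t ht => by
    rw [Set.uIcc_of_le hT] at ht
    linarith [ht.1]
  have huc : ContinuousOn u (Set.uIcc 1 T) := fun t ht =>
    (hu t (hpos t ht)).continuousAt.continuousWithinAt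
  have hDi := (hDc.comp_continuousOn huc).intervalIntegrable (μ := MeasureTheory.volume)
  have hfi := ((((contDiff_lorenzField σ b r (k := 1)).continuous.norm.pow 2).comp_continuousOn
    huc).const_smul (-k)).intervalIntegrable (μ := MeasureTheory.volume)
  have hFTC := intervalIntegral.integral_eq_sub_of_hasDerivAt
    (fun t ht => hasDerivAt_lorenzLyapunov hσ hb r N e (hu t (hpos t ht))) hDi
  have hmono := intervalIntegral.integral_mono_on hT hDi hfi fun t ht =>
    hrate (u t) (hR _ (hM₀ t (by linarith [ht.1])))
  have hconst : ∫ t in (1 : ℝ)..T, (-k) • ‖lorenzField σ b r (u t)‖ ^ 2 =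
      -k * ∫ t in (1 : ℝ)..T, ‖lorenzField σ b r (u t)‖ ^ 2 :=
    intervalIntegral.integral_smul _ _
  have h1 := (abs_le.1 (hL _ (hM₀ 1 zero_le_one))).2
  have h2 := (abs_le.1 (hL _ (hM₀ T (by linarith)))).1
  rw [le_div_iff₀ hk]
  have h3 : lorenzLyapunov σ b r N e (u T) - lorenzLyapunov σ b r N e (u 1) ≤
      -k * ∫ t in (1 : ℝ)..T, ‖lorenzField σ b r (u t)‖ ^ 2 := by
    rw [← hFTC, ← hconst]
    exact hmono
  linarith

/-- A bounded solution along which the squared speed has bounded integral has speed tending to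
zero. -/
theorem tendsto_velocity_of_bound_integral_sq {f : ℝ × ℝ × ℝ → ℝ × ℝ × ℝ} (hf : ContDiff ℝ 1 f)
    {K : Set (ℝ × ℝ × ℝ)} (hK : IsCompact K) {u : ℝ → ℝ × ℝ × ℝ}
    (hu : ∀ t, 0 ≤ t → HasDerivAt u (f (u t)) t) (huK : ∀ t, 0 ≤ t → u t ∈ K) {M : ℝ}
    (hM : ∀ T, 1 ≤ T → ∫ τ in (1 : ℝ)..T, ‖f (u τ)‖ ^ 2 ≤ M) :
    Tendsto (fun t => f (u t)) atTop (𝓝 0) := by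
  obtain ⟨C, hC⟩ := hK.exists_bound_of_continuousOn
    (hf.continuous_fderiv (by norm_num)).continuousOn
  have huc : ContinuousOn u (Set.Ici 0) := fun t ht => (hu t ht).continuousAt.continuousWithinAt
  have hfu : ContinuousOn (fun t => f (u t)) (Set.Ici 0) := hf.continuous.comp_continuousOn huc
  have hsub : Set.Ioi (1 : ℝ) ⊆ Set.Ici 0 :=
    fun t ht => zero_le_one.trans (Set.mem_Ioi.1 ht).le
  have hsq : MeasureTheory.IntegrableOn (fun t => ‖f (u t)‖ ^ 2) (Set.Ioi 1) := by
    refine MeasureTheory.integrableOn_Ioi_of_intervalIntegral_norm_bounded (l := atTop)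
      (b := id) M 1 (fun T => ?_) tendsto_id ?_
    · exact (((hfu.norm.pow 2).mono fun t ht => le_trans zero_le_one ht.1).integrableOn_compact
        (isCompact_Icc (a := (1 : ℝ)) (b := T))).mono_set Set.Ioc_subset_Icc_self
    · filter_upwards [eventually_ge_atTop 1] with T hT
      simpa using hM T hT
  set φ : ℝ → ℝ := fun t => dotForm (f (u t)) (f (u t)) with hφ
  set φ' : ℝ → ℝ := fun t => dotForm (f (u t)) (fderiv ℝ f (u t) (f (u t))) +
    dotForm (fderiv ℝ f (u t) (f (u t))) (f (u t)) with hφ'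
  have hfd : ∀ t, 0 ≤ t → HasDerivAt (fun t => f (u t)) (fderiv ℝ f (u t) (f (u t))) t :=
    fun t ht => ((hf.differentiable (by norm_num)) (u t)).hasFDerivAt.comp_hasDerivAt t (hu t ht)
  have hφd : ∀ t, 0 ≤ t → HasDerivAt φ (φ' t) t := fun t ht =>
    dotForm.hasDerivAt_of_bilinear (fun _ => hfd t ht) (fun _ => hfd t ht)
  have hφi : MeasureTheory.IntegrableOn φ (Set.Ioi 1) := by
    refine (hsq.const_mul ‖dotForm‖).mono' ?_ ?_
    · exact ContinuousOn.aestronglyMeasurable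
        (fun t ht => (hφd t (hsub ht)).continuousAt.continuousWithinAt) measurableSet_Ioi
    · refine Eventually.of_forall fun t => ?_
      rw [pow_two, ← mul_assoc]
      exact dotForm.le_opNorm₂ _ _
  have hφ'i : MeasureTheory.IntegrableOn φ' (Set.Ioi 1) := by
    refine (hsq.const_mul (2 * ‖dotForm‖ * C)).mono' ?_ ?_
    · refine ContinuousOn.aestronglyMeasurable ?_ measurableSet_Ioi
      have h1 := hfu.mono hsub
      have h2 := ((hf.continuous_fderiv (by norm_num)).comp_continuousOn (huc.mono hsub)).clm_apply
        h1
      have h3 : ∀ {g k : ℝ → ℝ × ℝ × ℝ}, ContinuousOn g (Set.Ioi 1) → ContinuousOn k (Set.Ioi 1) →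
          ContinuousOn (fun t => dotForm (g t) (k t)) (Set.Ioi 1) := fun hg hk =>
        (dotForm.continuous.comp_continuousOn hg).clm_apply hk
      exact (h3 h1 h2).add (h3 h2 h1)
    · refine (MeasureTheory.ae_restrict_iff' measurableSet_Ioi).2 (Eventually.of_forall
        fun t ht => ?_)
      have h1 : ‖fderiv ℝ f (u t) (f (u t))‖ ≤ C * ‖f (u t)‖ :=
        (fderiv ℝ f (u t)).le_of_opNorm_le (hC _ (huK t (hsub ht))) _
      have h2 := dotForm.le_opNorm₂ (f (u t)) (fderiv ℝ f (u t) (f (u t)))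
      have h3 := dotForm.le_opNorm₂ (fderiv ℝ f (u t) (f (u t))) (f (u t))
      have h4 := mul_le_mul_of_nonneg_left h1
        (by positivity : 0 ≤ 2 * ‖dotForm‖ * ‖f (u t)‖)
      refine (norm_add_le _ _).trans ?_
      linarith
  have hlim := MeasureTheory.tendsto_zero_of_hasDerivAt_of_integrableOn_Ioi
    (fun t ht => hφd t (hsub ht)) hφ'i hφi
  have hlim2 : Tendsto (fun t => ‖f (u t)‖ ^ 2) atTop (𝓝 0) :=
    squeeze_zero (fun t => sq_nonneg _) (fun t => sq_norm_le_dotForm _) hlim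
  have hlim3 := hlim2.sqrt
  simp only [Real.sqrt_sq (norm_nonneg _), Real.sqrt_zero] at hlim3
  exact tendsto_zero_iff_norm_tendsto_zero.2 hlim3

/-- A function with values in a compact set along which a continuous map tends to zero approaches
the zero set of that map. -/
theorem tendsto_infDist_zeros {E F : Type*} [PseudoMetricSpace E] [NormedAddCommGroup F]
    {f : E → F} (hf : Continuous f) {K : Set E} (hK : IsCompact K) {u : ℝ → E}
    (huK : ∀ t, 0 ≤ t → u t ∈ K) (hlim : Tendsto (fun t => f (u t)) atTop (𝓝 0)) :
    Tendsto (fun t => Metric.infDist (u t) {p | f p = 0}) atTop (𝓝 0) := by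
  refine tendsto_order.2 ⟨fun a ha => Eventually.of_forall fun t =>
    ha.trans_le Metric.infDist_nonneg, fun ε hε => ?_⟩
  set K' := K ∩ {p | ε ≤ Metric.infDist p {p | f p = 0}} with hK'
  have hcl : IsCompact K' := hK.inter_right
    (isClosed_le continuous_const (Metric.continuous_infDist_pt _))
  have hδ : ∃ δ > 0, ∀ p ∈ K', δ ≤ ‖f p‖ := by
    rcases K'.eq_empty_or_nonempty with he | hne
    · exact ⟨1, one_pos, by simp [he]⟩
    · obtain ⟨p, hp, hmin⟩ := hcl.exists_isMinOn hne hf.norm.continuousOn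
      refine ⟨‖f p‖, norm_pos_iff.2 fun h0 => ?_, fun q hq => hmin hq⟩
      have h1 : Metric.infDist p {p | f p = 0} = 0 := Metric.infDist_zero_of_mem h0
      have h2 : ε ≤ Metric.infDist p {p | f p = 0} := hp.2
      linarith
  obtain ⟨δ, hδ0, hδ⟩ := hδ
  have hn := hlim.norm
  rw [norm_zero] at hn
  filter_upwards [hn.eventually (gt_mem_nhds hδ0), eventually_ge_atTop 0] with t h1 h2
  by_contra hcon
  exact absurd (hδ (u t) ⟨huK t h2, not_lt.1 hcon⟩) (not_le.2 h1)

/-- Solutions of the Lorenz system approach the zero set of the vector field. -/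
theorem tendsto_infDist_lorenzField_zeros {σ b r : ℝ} (hσ : 0 < σ) (hb : 0 < b) (hb4 : b ≤ 4)
    (hr : 0 < r) (hcond : 2 * σ ≤ b ∨ (b < 2 * σ ∧ r < (σ + b) * (b + 1) / σ))
    {u : ℝ → ℝ × ℝ × ℝ} (hu : ∀ t, 0 ≤ t → HasDerivAt u (lorenzField σ b r (u t)) t) :
    Tendsto (fun t => Metric.infDist (u t) {p | lorenzField σ b r p = 0}) atTop (𝓝 0) := by
  obtain ⟨M, hM⟩ : ∃ M, ∀ T, 1 ≤ T → ∫ τ in (1 : ℝ)..T, ‖lorenzField σ b r (u τ)‖ ^ 2 ≤ M := by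
    rcases hcond with h | ⟨h, hr'⟩
    · exact exists_bound_integral_sq_lorenzField_of_lyapunov hσ hb hr h hu
    · exact exists_bound_integral_sq_lorenzField_of_area_contraction hσ hb hb4 hr h hr' hu
  obtain ⟨M₀, hM₀⟩ := lorenz_bounded hσ hb hr hu
  have hK := isCompact_lorenzEnergy_le hσ hr M₀
  exact tendsto_infDist_zeros (contDiff_lorenzField σ b r (k := 1)).continuous hK hM₀
    (tendsto_velocity_of_bound_integral_sq (contDiff_lorenzField σ b r) hK hu hM₀ hM)

/-- **Global stability of the Lorenz system.**
For the Lorenz system ẋ = −σ(x−y), ẏ = rx − y − xz, ż = −bz + xy with σ > 0,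
b ∈ (0,4], r > 0, if either 2σ ≤ b, or (2σ > b and r < (σ+b)(b+1)/σ), then every
solution defined on [0,∞) converges to the stationary set: the distance from
(x(t),y(t),z(t)) to the set of equilibria tends to 0 as t → +∞. -/
theorem lorenz_global_stability
    (σ b r : ℝ) (hσ : 0 < σ) (hb : 0 < b) (hb4 : b ≤ 4) (hr : 0 < r)
    (hcond : 2 * σ ≤ b ∨ (b < 2 * σ ∧ r < (σ + b) * (b + 1) / σ))
    (x y z : ℝ → ℝ)
    (hx : ∀ t : ℝ, 0 ≤ t → HasDerivAt x (-σ * (x t - y t)) t)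
    (hy : ∀ t : ℝ, 0 ≤ t → HasDerivAt y (r * x t - y t - x t * z t) t)
    (hz : ∀ t : ℝ, 0 ≤ t → HasDerivAt z (-b * z t + x t * y t) t) :
    Tendsto (fun t : ℝ => Metric.infDist ((x t, y t, z t) : ℝ × ℝ × ℝ)
      {p : ℝ × ℝ × ℝ | -σ * (p.1 - p.2.1) = 0 ∧
        r * p.1 - p.2.1 - p.1 * p.2.2 = 0 ∧
        -b * p.2.2 + p.1 * p.2.1 = 0}) atTop (𝓝 0) := by
  have hset : {p : ℝ × ℝ × ℝ | -σ * (p.1 - p.2.1) = 0 ∧ r * p.1 - p.2.1 - p.1 * p.2.2 = 0 ∧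
      -b * p.2.2 + p.1 * p.2.1 = 0} = {p | lorenzField σ b r p = 0} := by
    ext p
    simp only [lorenzField, Set.mem_ofPred_eq, Prod.mk_eq_zero]
  rw [hset]
  exact tendsto_infDist_lorenzField_zeros (u := fun t => (x t, y t, z t)) hσ hb hb4 hr hcond
    fun t ht => (hx t ht).prodMk ((hy t ht).prodMk (hz t ht))
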